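/- Let A be a separable, simple, unital, exact, pure C*-algebra of stable rank one and let α : G → Aut(A) be an action of a finite group G with the Rokhlin property. Then the fixed point algebra A^α is pure. -/

import Mathlib

noncomputable section
set_option linter.unusedSectionVars false

open scoped ComplexOrder Matrix.Norms.L2Operator
open Filter Topology

/-- An element of a `*`-ring is *positive* (in the C*-algebraic sense) if it has the
form `star y * y`. -/
def IsPosElem {R : Type*} [Mul R] [Star R] (a : R) : Prop :=
  ∃ y : R, a = star y * y

/-- A linear functional on a unital complex `*`-algebra is a *tracial state* if it is unital,
positive and tracial. -/
def IsTracialState {R : Type*} [Ring R] [StarRing R] [Module ℂ R] (τ : R →ₗ[ℂ] ℂ) : Prop :=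
  τ 1 = 1 ∧ (∀ x : R, 0 ≤ τ (star x * x)) ∧ ∀ a b : R, τ (a * b) = τ (b * a)

/-- A linear map between complex `*`-algebras is *completely positive* if all of its matrix
amplifications map positive elements to positive elements. -/
def IsCompletelyPositive {A B : Type*} [Ring A] [StarRing A] [Module ℂ A]
    [Ring B] [StarRing B] [Module ℂ B] (φ : A →ₗ[ℂ] B) : Prop :=
  ∀ (k : ℕ) (x : Matrix (Fin k) (Fin k) A), IsPosElem x → IsPosElem (x.map φ)

/-- A map has *order zero* on a subset if it preserves orthogonality there. -/
def OrderZeroOn {F D : Type*} [Mul F] [Zero F] [Mul D] [Zero D] (φ : F → D) (s : Set F) : Prop :=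
  ∀ e ∈ s, ∀ f ∈ s, e * f = 0 → f * e = 0 → φ e * φ f = 0 ∧ φ f * φ e = 0

/-- The finite-dimensional C*-algebra `⊕_{i=1}^s M_{r i}(ℂ)`. -/
abbrev FDBlock (s : ℕ) (r : Fin s → ℕ) : Type :=
  ∀ i : Fin s, Matrix (Fin (r i)) (Fin (r i)) ℂ

/-- The elements of `⊕_{i=1}^s M_{r i}(ℂ)` supported on the blocks with label `j`. -/
def blockSupp {s : ℕ} {r : Fin s → ℕ} {n : ℕ} (J : Fin s → Fin (n + 1)) (j : Fin (n + 1)) :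
    Set (FDBlock s r) :=
  {x | ∀ i : Fin s, J i ≠ j → x i = 0}

/-- `DecompositionRankLE n D` : the C*-algebra `D` has decomposition rank at most `n`. -/
def DecompositionRankLE (n : ℕ) (D : Type*) [NormedRing D] [StarRing D]
    [NormedAlgebra ℂ D] : Prop :=
  ∀ (S : Finset D) (ε : ℝ), 0 < ε →
    ∃ (s : ℕ) (r : Fin s → ℕ) (J : Fin s → Fin (n + 1))
      (ψ : D →ₗ[ℂ] FDBlock s r) (φ : FDBlock s r →ₗ[ℂ] D),
      IsCompletelyPositive ψ ∧ IsCompletelyPositive φ ∧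
      (∀ a : D, ‖ψ a‖ ≤ ‖a‖) ∧ (∀ x : FDBlock s r, ‖φ x‖ ≤ ‖x‖) ∧
      (∀ j : Fin (n + 1), OrderZeroOn φ (blockSupp J j)) ∧
      ∀ a ∈ S, ‖φ (ψ a) - a‖ < ε

/-- `NuclearDimensionLE n D` : the C*-algebra `D` has nuclear dimension at most `n`. -/
def NuclearDimensionLE (n : ℕ) (D : Type*) [NormedRing D] [StarRing D]
    [NormedAlgebra ℂ D] : Prop :=
  ∀ (S : Finset D) (ε : ℝ), 0 < ε →
    ∃ (s : ℕ) (r : Fin s → ℕ) (J : Fin s → Fin (n + 1))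
      (ψ : D →ₗ[ℂ] FDBlock s r) (φ : FDBlock s r →ₗ[ℂ] D),
      IsCompletelyPositive ψ ∧ IsCompletelyPositive φ ∧
      (∀ a : D, ‖ψ a‖ ≤ ‖a‖) ∧
      (∀ j : Fin (n + 1), (∀ x ∈ blockSupp J j, ‖φ x‖ ≤ ‖x‖) ∧
        OrderZeroOn φ (blockSupp J j)) ∧
      ∀ a ∈ S, ‖φ (ψ a) - a‖ < ε

/-- A bundled unital C*-algebra. -/
structure CStarAlg : Type 1 where
  carrier : Type
  [str : CStarAlgebra carrier]

attribute [instance] CStarAlg.str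

/-- The *finite saturation* of a class `𝒞` of unital C*-algebras: the smallest class
containing `𝒞` which is closed under isomorphism, finite direct sums, matrix amplifications
and corners by nonzero projections. -/
inductive FinSat (𝒞 : CStarAlg → Prop) : CStarAlg → Prop
  | base {B : CStarAlg} : 𝒞 B → FinSat 𝒞 B
  | iso {B B' : CStarAlg} : FinSat 𝒞 B → Nonempty (B'.carrier ≃⋆ₐ[ℂ] B.carrier) →
      FinSat 𝒞 B'
  | sum {B₁ B₂ B : CStarAlg} : FinSat 𝒞 B₁ → FinSat 𝒞 B₂ →
      Nonempty (B.carrier ≃⋆ₐ[ℂ] (B₁.carrier × B₂.carrier)) → FinSat 𝒞 B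
  | matrix {B B' : CStarAlg} (k : ℕ) : FinSat 𝒞 B →
      Nonempty (B'.carrier ≃⋆ₐ[ℂ] Matrix (Fin (k + 1)) (Fin (k + 1)) B.carrier) →
      FinSat 𝒞 B'
  | corner {B B' : CStarAlg} (p : B.carrier) : FinSat 𝒞 B → p ≠ 0 → p * p = p →
      star p = p →
      (∃ ι : B'.carrier →⋆ₙₐ[ℂ] B.carrier, Function.Injective ι ∧ ι 1 = p ∧
        Set.range ι = {x : B.carrier | p * x * p = x}) →
      FinSat 𝒞 B'

/-- `A` is a *unital local `𝒞`-algebra*. -/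
def IsUnitalLocalAlg (𝒞 : CStarAlg → Prop) (A : Type*) [NormedRing A] [StarRing A]
    [NormedAlgebra ℂ A] : Prop :=
  ∀ (S : Finset A) (ε : ℝ), 0 < ε →
    ∃ B : CStarAlg, FinSat 𝒞 B ∧
      ∃ φ : B.carrier →⋆ₐ[ℂ] A, ∀ a ∈ S, ∃ b : B.carrier, ‖a - φ b‖ < ε

/-- The class of separable unital C*-algebras with decomposition rank at most `n`. -/
def drClass (n : ℕ) : CStarAlg → Prop :=
  fun B => TopologicalSpace.SeparableSpace B.carrier ∧ DecompositionRankLE n B.carrier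

/-- The class of separable unital C*-algebras with nuclear dimension at most `n`. -/
def nucClass (n : ℕ) : CStarAlg → Prop :=
  fun B => TopologicalSpace.SeparableSpace B.carrier ∧ NuclearDimensionLE n B.carrier

/-- The class of separable unital C*-algebras with finite nuclear dimension. -/
def lnucClass : CStarAlg → Prop :=
  fun B => TopologicalSpace.SeparableSpace B.carrier ∧ ∃ n : ℕ, NuclearDimensionLE n B.carrier

/-- A separable unital C*-algebra has *locally finite nuclear dimension* if it is a
unital local `C_lnuc`-algebra. -/
def HasLocallyFiniteNuclearDimension (A : Type*) [NormedRing A] [StarRing A]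
    [NormedAlgebra ℂ A] : Prop :=
  IsUnitalLocalAlg lnucClass A
/-! ### Group actions and the Rokhlin property -/

/-- `α : G → (A →⋆ₐ[ℂ] A)` is an action of the group `G` on `A` by *-automorphisms. -/
def IsGroupAction {G A : Type*} [Group G] [CStarAlgebra A] (α : G → (A →⋆ₐ[ℂ] A)) : Prop :=
  (∀ a : A, α 1 a = a) ∧ ∀ (g h : G) (a : A), α g (α h a) = α (g * h) a

/-- The fixed point algebra `A^α` of an action, as a star subalgebra of `A`. -/
def fixedPointAlgebra {G A : Type*} [Group G] [CStarAlgebra A] (α : G → (A →⋆ₐ[ℂ] A)) :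
    StarSubalgebra ℂ A where
  carrier := {a : A | ∀ g : G, α g a = a}
  mul_mem' := fun {a} {b} ha hb g => by rw [map_mul, ha g, hb g]
  add_mem' := fun {a} {b} ha hb g => by rw [map_add, ha g, hb g]
  algebraMap_mem' := fun c g => by rw [AlgHomClass.commutes]
  star_mem' := fun {a} ha g => by rw [map_star, ha g]

/-- The Rokhlin property for a finite group action, expressed in terms of representing
sequences for projections in `A_∞ = (ℓ^∞(ℕ,A)/c₀(ℕ,A)) ∩ A'`. -/
def ActionHasRokhlin {G A : Type*} [Group G] [Fintype G] [CStarAlgebra A]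
    (α : G → (A →⋆ₐ[ℂ] A)) : Prop :=
  ∃ e : G → ℕ → A,
    (∀ g, ∃ M : ℝ, ∀ k, ‖e g k‖ ≤ M) ∧
    (∀ g, Tendsto (fun k => ‖e g k * e g k - e g k‖) atTop (𝓝 0)) ∧
    (∀ g, Tendsto (fun k => ‖star (e g k) - e g k‖) atTop (𝓝 0)) ∧
    (∀ g (a : A), Tendsto (fun k => ‖e g k * a - a * e g k‖) atTop (𝓝 0)) ∧
    Tendsto (fun k => ‖(∑ g : G, e g k) - 1‖) atTop (𝓝 0) ∧
    (∀ g h, Tendsto (fun k => ‖α g (e h k) - e (g * h) k‖) atTop (𝓝 0))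

/-! ### Inclusions of unital C*-algebras, conditional expectations, Watatani index -/

variable {P A : Type*}

/-- `E : A →ₗ[ℂ] P` is a conditional expectation onto the subalgebra `P` (included in `A`
via the injective unital *-homomorphism `ι`). -/
structure IsCondExpect [CStarAlgebra P] [CStarAlgebra A] (ι : P →⋆ₐ[ℂ] A)
    (E : A →ₗ[ℂ] P) : Prop where
  restricts : ∀ p : P, E (ι p) = p
  pos : ∀ x : A, IsPosElem (E (star x * x))
  bimodule : ∀ (p q : P) (x : A), E (ι p * x * ι q) = p * E x * q

/-- `{(u i, v i)}` is a quasi-basis for the conditional expectation `E`; the existence of a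
quasi-basis says precisely that `E` is of index-finite type. -/
def IsQuasiBasis [CStarAlgebra P] [CStarAlgebra A] (ι : P →⋆ₐ[ℂ] A) (E : A →ₗ[ℂ] P)
    {m : ℕ} (u v : Fin m → A) : Prop :=
  ∀ a : A, (a = ∑ i, u i * ι (E (v i * a))) ∧ (a = ∑ i, ι (E (a * u i)) * v i)

/-- The Rokhlin property for a conditional expectation of index-finite type with index
`ind = ∑ u i * v i` : there is a projection `e` in `A_∞ = (ℓ^∞(ℕ,A)/c₀(ℕ,A)) ∩ A'`
(given by a representing sequence) with `E^∞(e) = (Index E)⁻¹ · 1` such that `x ↦ x e`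
is injective on `A`. -/
def CondExpectHasRokhlin [CStarAlgebra P] [CStarAlgebra A] (ι : P →⋆ₐ[ℂ] A)
    (E : A →ₗ[ℂ] P) (ind : A) : Prop :=
  ∃ e : ℕ → A,
    (∃ M : ℝ, ∀ k, ‖e k‖ ≤ M) ∧
    Tendsto (fun k => ‖e k * e k - e k‖) atTop (𝓝 0) ∧
    Tendsto (fun k => ‖star (e k) - e k‖) atTop (𝓝 0) ∧
    (∀ a : A, Tendsto (fun k => ‖e k * a - a * e k‖) atTop (𝓝 0)) ∧
    (∃ w : A, w * ind = 1 ∧ ind * w = 1 ∧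
      Tendsto (fun k => ‖ι (E (e k)) - w‖) atTop (𝓝 0)) ∧
    (∀ x : A, Tendsto (fun k => ‖x * e k‖) atTop (𝓝 0) → x = 0)

/-! ### Cuntz comparison, dimension functions, strict comparison, almost divisibility -/

/-- Cuntz subequivalence for positive matrices over a C*-algebra (the topology on matrices
over a C*-algebra is the norm topology, which agrees with the product topology). -/
def CuntzSub {R : Type*} [NonUnitalNonAssocSemiring R] [Star R] [TopologicalSpace R]
    {m k : Type*} [Fintype m] [Fintype k] (a : Matrix m m R) (b : Matrix k k R) : Prop :=
  ∃ v : ℕ → Matrix m k R, Tendsto (fun j => v j * b * (v j).conjTranspose) atTop (𝓝 a)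

/-- `matNthRoot a j` is the (unique, if it exists) positive `j`-th root `a^{1/j}` of a
positive matrix `a` over a C*-algebra. -/
def matNthRoot {R : Type*} [Ring R] [StarRing R] {m : Type*} [Fintype m] [DecidableEq m]
    (a : Matrix m m R) (j : ℕ) : Matrix m m R :=
  open scoped Classical in
  if h : ∃ b : Matrix m m R, IsPosElem b ∧ b ^ j = a then h.choose else 0

/-- The standard extension `τ ⊗ Tr` of a functional `τ` to matrices. -/
def traceExt {R : Type*} [Ring R] [Module ℂ R] {m : Type*} [Fintype m]
    (τ : R →ₗ[ℂ] ℂ) (x : Matrix m m R) : ℂ :=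
  ∑ i, τ (x i i)

/-- The dimension function `d_τ(a) = lim_{n → ∞} τ(a^{1/n})` associated to a tracial
state `τ` (the limit exists, so it agrees with the `limsup` used here). -/
def dimFun {R : Type*} [Ring R] [StarRing R] [Module ℂ R] {m : Type*} [Fintype m]
    [DecidableEq m] (τ : R →ₗ[ℂ] ℂ) (a : Matrix m m R) : ℝ :=
  Filter.limsup (fun j : ℕ => (traceExt τ (matNthRoot a (j + 1))).re) atTop

/-- A unital C*-algebra `R` has *strict comparison* (of positive elements, with respect to
tracial states) if `d_τ(a) < d_τ(b)` for all tracial states `τ` implies `a ≾ b`. -/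
def HasStrictComparison (R : Type*) [Ring R] [StarRing R] [Module ℂ R]
    [TopologicalSpace R] : Prop :=
  ∀ (m k : ℕ) (a : Matrix (Fin m) (Fin m) R) (b : Matrix (Fin k) (Fin k) R),
    IsPosElem a → IsPosElem b →
    (∀ τ : R →ₗ[ℂ] ℂ, IsTracialState τ → dimFun τ a < dimFun τ b) →
    CuntzSub a b

/-- The Cuntz semigroup `W(R)` is *almost divisible*: for every positive contraction `a`
over `R` and every `k ≠ 0` there is `x = ⟨c⟩ ∈ W(R)` with `k ⬝ x ≤ ⟨a⟩ ≤ (k+1) ⬝ x`. -/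
def AlmostDivisible (R : Type*) [Ring R] [StarRing R] [TopologicalSpace R] : Prop :=
  ∀ (m : ℕ) (a : Matrix (Fin m) (Fin m) R),
    IsPosElem a → IsPosElem ((1 : Matrix (Fin m) (Fin m) R) - a) →
    ∀ k : ℕ, k ≠ 0 →
      ∃ (l : ℕ) (c : Matrix (Fin l) (Fin l) R), IsPosElem c ∧
        CuntzSub (Matrix.blockDiagonal fun _ : Fin k => c) a ∧
        CuntzSub a (Matrix.blockDiagonal fun _ : Fin (k + 1) => c)

/-- A unital C*-algebra is *pure* if it has strict comparison and almost divisible Cuntz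
semigroup. -/
def IsPure (R : Type*) [Ring R] [StarRing R] [Module ℂ R] [TopologicalSpace R] : Prop :=
  HasStrictComparison R ∧ AlmostDivisible R

/-- The order on projections over `R` is determined by traces. -/
def ProjOrderDeterminedByTraces (R : Type*) [Ring R] [StarRing R] [Module ℂ R] : Prop :=
  ∀ (k l : ℕ) (p : Matrix (Fin k) (Fin k) R) (q : Matrix (Fin l) (Fin l) R),
    p * p = p → star p = p → q * q = q → star q = q →
    (∀ τ : R →ₗ[ℂ] ℂ, IsTracialState τ → (traceExt τ p).re < (traceExt τ q).re) →
    ∃ v : Matrix (Fin l) (Fin k) R,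
      v.conjTranspose * v = p ∧ IsPosElem (q - v * v.conjTranspose)

/-- A unital C*-algebra has stable rank one if its invertible elements are dense. -/
def HasStableRankOne (R : Type*) [Ring R] [TopologicalSpace R] : Prop :=
  Dense {x : R | IsUnit x}

/-- A unital C*-algebra is simple if it has no nontrivial closed two-sided ideals. -/
def IsSimpleCStarAlgebra (A : Type*) [CStarAlgebra A] : Prop :=
  ∀ I : TwoSidedIdeal A, IsClosed (I : Set A) → I = ⊥ ∨ I = ⊤
/-! ### Corners `pRp` by a projection `p` -/

section CornerSection

variable {R : Type*} [Ring R] [StarRing R] [Algebra ℂ R] [StarModule ℂ R]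

/-- The corner `p R p` of a unital C*-algebra `R` by a projection `p`, as a unital
`*`-algebra with unit `p`. -/
def Corner (p : R) (_hp : p * p = p) (_hsp : star p = p) : Type _ :=
  {x : R // p * x * p = x}

namespace Corner

variable {p : R} {hp : p * p = p} {hsp : star p = p}

theorem mem_mul_left (hp : p * p = p) {x : R} (hx : p * x * p = x) : p * x = x := by
  conv_lhs => rw [← hx]
  simp only [← mul_assoc]
  rw [hp, hx]

theorem mem_mul_right (hp : p * p = p) {x : R} (hx : p * x * p = x) : x * p = x := by
  conv_lhs => rw [← hx]
  rw [mul_assoc, mul_assoc, hp, ← mul_assoc, hx]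

instance : Add (Corner p hp hsp) :=
  ⟨fun x y => ⟨x.1 + y.1, by rw [mul_add, add_mul, x.2, y.2]⟩⟩

instance : Zero (Corner p hp hsp) :=
  ⟨⟨0, by rw [mul_zero, zero_mul]⟩⟩

instance : Neg (Corner p hp hsp) :=
  ⟨fun x => ⟨-x.1, by rw [mul_neg, neg_mul, x.2]⟩⟩

instance : Mul (Corner p hp hsp) :=
  ⟨fun x y => ⟨x.1 * y.1, by
    rw [← mul_assoc p x.1 y.1, mem_mul_left hp x.2, mul_assoc x.1 y.1 p,
      mem_mul_right hp y.2]⟩⟩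

instance : One (Corner p hp hsp) :=
  ⟨⟨p, by rw [hp, hp]⟩⟩

instance : SMul ℂ (Corner p hp hsp) :=
  ⟨fun c x => ⟨c • x.1, by rw [mul_smul_comm, smul_mul_assoc, x.2]⟩⟩

instance : Star (Corner p hp hsp) :=
  ⟨fun x => ⟨star x.1, by
    conv_rhs => rw [← x.2]
    rw [star_mul, star_mul, hsp, ← mul_assoc]⟩⟩

@[simp] theorem val_add (x y : Corner p hp hsp) : (x + y).1 = x.1 + y.1 := rfl
@[simp] theorem val_mul (x y : Corner p hp hsp) : (x * y).1 = x.1 * y.1 := rfl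
@[simp] theorem val_zero : (0 : Corner p hp hsp).1 = 0 := rfl
@[simp] theorem val_one : (1 : Corner p hp hsp).1 = p := rfl
@[simp] theorem val_neg (x : Corner p hp hsp) : (-x).1 = -x.1 := rfl
@[simp] theorem val_smul (c : ℂ) (x : Corner p hp hsp) : (c • x).1 = c • x.1 := rfl
@[simp] theorem val_star (x : Corner p hp hsp) : (star x).1 = star x.1 := rfl

instance instRing : Ring (Corner p hp hsp) where
  add_assoc x y z := Subtype.ext <| by simp [add_assoc]
  zero_add x := Subtype.ext <| by simp
  add_zero x := Subtype.ext <| by simp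
  add_comm x y := Subtype.ext <| by simp [add_comm]
  neg_add_cancel x := Subtype.ext <| by simp
  nsmul := nsmulRec
  zsmul := zsmulRec
  mul_assoc x y z := Subtype.ext <| by simp [mul_assoc]
  one_mul x := Subtype.ext <| by simpa using mem_mul_left hp x.2
  mul_one x := Subtype.ext <| by simpa using mem_mul_right hp x.2
  left_distrib x y z := Subtype.ext <| by simp [left_distrib]
  right_distrib x y z := Subtype.ext <| by simp [right_distrib]
  zero_mul x := Subtype.ext <| by simp
  mul_zero x := Subtype.ext <| by simp

instance instStarRing : StarRing (Corner p hp hsp) where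
  star_involutive x := Subtype.ext <| by simp
  star_mul x y := Subtype.ext <| by simp
  star_add x y := Subtype.ext <| by simp

instance instModule : Module ℂ (Corner p hp hsp) where
  one_smul x := Subtype.ext <| by simp
  mul_smul c d x := Subtype.ext <| by simp [mul_smul]
  smul_zero c := Subtype.ext <| by simp
  smul_add c x y := Subtype.ext <| by simp
  add_smul c d x := Subtype.ext <| by simp [add_smul]
  zero_smul x := Subtype.ext <| by simp

instance instTop [TopologicalSpace R] : TopologicalSpace (Corner p hp hsp) :=
  instTopologicalSpaceSubtype

end Corner

end CornerSection

/-! ### Sequence algebras: `A^∞ = ℓ^∞(ℕ, A)/c₀(ℕ, A)` via representing sequences -/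

/-- A sequence in a normed space is null (i.e. lies in `c₀(ℕ, A)`). -/
def IsNullSeq {A : Type*} [Norm A] (x : ℕ → A) : Prop :=
  Tendsto (fun n => ‖x n‖) atTop (𝓝 0)

/-- A sequence in a normed space is bounded (i.e. lies in `ℓ^∞(ℕ, A)`). -/
def IsBddSeq {A : Type*} [Norm A] (x : ℕ → A) : Prop :=
  ∃ M : ℝ, ∀ n, ‖x n‖ ≤ M

/-- A linear map `β : A →ₗ[ℂ] ℓ^∞(ℕ, P)` represents a unital *-homomorphism
`A → P^∞ = ℓ^∞(ℕ, P)/c₀(ℕ, P)` : it takes values in bounded sequences and is unital,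
multiplicative and star-preserving modulo `c₀(ℕ, P)`. -/
structure RepresentsHomToSeqAlg {A P : Type*} [CStarAlgebra A] [CStarAlgebra P]
    (β : A →ₗ[ℂ] (ℕ → P)) : Prop where
  bdd : ∀ x : A, IsBddSeq (β x)
  unital : IsNullSeq (β 1 - 1)
  mul : ∀ x y : A, IsNullSeq (β (x * y) - β x * β y)
  star : ∀ x : A, IsNullSeq (β (star x) - star (β x))

/-- A Banach limit: a linear functional on (bounded) complex sequences which is unital,
shift-invariant, positive and bounded. -/
structure IsBanachLimit (L : (ℕ → ℂ) →ₗ[ℂ] ℂ) : Prop where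
  unital : L 1 = 1
  shift : ∀ x : ℕ → ℂ, IsBddSeq x → L (fun n => x (n + 1)) = L x
  pos : ∀ x : ℕ → ℂ, IsBddSeq x → (∀ n, 0 ≤ x n) → 0 ≤ L x
  norm_le : ∀ (x : ℕ → ℂ) (M : ℝ), (∀ n, ‖x n‖ ≤ M) → ‖L x‖ ≤ M

/-- A C*-algebra is *exact* iff it is nuclearly embeddable (Kirchberg): it admits a faithful
representation `π : A → B(H)` which approximately factors through matrix algebras by
completely positive contractions in the point-norm topology. -/
def IsExactCStar (A : Type*) [CStarAlgebra A] : Prop :=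
  ∃ (H : Type) (_ : NormedAddCommGroup H) (_ : InnerProductSpace ℂ H) (_ : CompleteSpace H)
    (π : A →⋆ₐ[ℂ] (H →L[ℂ] H)), Function.Injective π ∧
      ∀ (S : Finset A) (ε : ℝ), 0 < ε →
        ∃ (k : ℕ) (ψ : A →ₗ[ℂ] Matrix (Fin k) (Fin k) ℂ)
          (φ : Matrix (Fin k) (Fin k) ℂ →ₗ[ℂ] (H →L[ℂ] H)),
          IsCompletelyPositive ψ ∧ IsCompletelyPositive φ ∧
          (∀ a : A, ‖ψ a‖ ≤ ‖a‖) ∧ (∀ x, ‖φ x‖ ≤ ‖x‖) ∧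
          ∀ a ∈ S, ‖φ (ψ a) - π a‖ < ε


section Abs
variable {B : Type*} [CStarAlgebra B] [PartialOrder B] [StarOrderedRing B]

def rt (n : ℕ) (a : B) : B := cfc (fun x : ℝ => x ^ ((n + 1 : ℝ)⁻¹)) a

theorem rt_expo_pos (n : ℕ) : (0 : ℝ) < ((n + 1 : ℝ)⁻¹) := by positivity

theorem rt_expo_le (n : ℕ) : ((n + 1 : ℝ)⁻¹) ≤ 1 := by
  apply inv_le_one_of_one_le₀; simp

theorem rt_cont (n : ℕ) : Continuous (fun x : ℝ => x ^ ((n + 1 : ℝ)⁻¹)) :=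
  Real.continuous_rpow_const (rt_expo_pos n).le

theorem rt_nonneg (n : ℕ) {a : B} (ha : 0 ≤ a) : 0 ≤ rt n a :=
  cfc_nonneg fun x hx => Real.rpow_nonneg (spectrum_nonneg_of_nonneg ha hx) _

theorem rt_pow (n : ℕ) {a : B} (ha : 0 ≤ a) : rt n a ^ (n + 1) = a := by
  rw [rt, ← cfc_pow (fun x : ℝ => x ^ ((n + 1 : ℝ)⁻¹)) (n+1) a (rt_cont n).continuousOn]
  conv_rhs => rw [← cfc_id' ℝ a]
  apply cfc_congr
  intro x hx
  have h0 : 0 ≤ x := spectrum_nonneg_of_nonneg ha hx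
  have := Real.rpow_inv_natCast_pow h0 (n := n+1) (by omega)
  simpa using this

theorem rt_unique (n : ℕ) {b : B} (hb : 0 ≤ b) : rt n (b ^ (n + 1)) = b := by
  rw [rt, ← cfc_pow_id (R := ℝ) b (n+1), ← cfc_comp _ _ b (hg := (rt_cont n).continuousOn)]
  conv_rhs => rw [← cfc_id' ℝ b]
  apply cfc_congr
  intro x hx
  have h0 : 0 ≤ x := spectrum_nonneg_of_nonneg hb hx
  have := Real.pow_rpow_inv_natCast h0 (n := n+1) (by omega)
  simpa using this

theorem rt_unique' (n : ℕ) {a b : B} (hb : 0 ≤ b) (h : b ^ (n + 1) = a) : b = rt n a := by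
  rw [← h, rt_unique n hb]

theorem rt_zero_idx {a : B} (ha : 0 ≤ a) : rt 0 a = a := by
  have := rt_pow 0 ha
  simpa using this

theorem rt_mono (n : ℕ) {a b : B} (ha : 0 ≤ a) (h : a ≤ b) : rt n a ≤ rt n b := by
  have := CFC.rpow_le_rpow (p := ((n + 1 : ℝ)⁻¹)) ⟨(rt_expo_pos n).le, rt_expo_le n⟩ h
  rwa [CFC.rpow_eq_cfc_real ha, CFC.rpow_eq_cfc_real (ha.trans h)] at this

theorem rt_smul (n : ℕ) {a : B} (ha : 0 ≤ a) {s : ℝ} (hs : 0 ≤ s) :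
    rt n (s • a) = (s ^ ((n + 1 : ℝ)⁻¹)) • rt n a := by
  symm
  apply rt_unique' n (smul_nonneg (Real.rpow_nonneg hs _) (rt_nonneg n ha))
  rw [smul_pow, rt_pow n ha]
  have := Real.rpow_inv_natCast_pow hs (n := n+1) (by omega)
  congr 1
  simpa using this

theorem spec_le {a : B} {S : ℝ} (ha : 0 ≤ a) (h : ‖a‖ ≤ S) : spectrum ℝ a ⊆ Set.Icc 0 S := by
  intro x hx
  refine ⟨spectrum_nonneg_of_nonneg ha hx, ?_⟩
  rcases subsingleton_or_nontrivial B with hB | hB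
  · exact absurd hx (by simp [spectrum.of_subsingleton])
  exact (le_abs_self x).trans ((spectrum.norm_le_norm_of_mem hx).trans h)

theorem rt_succ (n k : ℕ) (hnk : n ≤ k) {a : B} (ha : 0 ≤ a) (h : ‖a‖ ≤ 1) : rt n a ≤ rt k a := by
  apply cfc_mono (hf := (rt_cont n).continuousOn) (hg := (rt_cont k).continuousOn)
  intro x hx
  obtain ⟨h0, h1⟩ := spec_le ha h hx
  rcases h0.eq_or_lt with h0 | h0
  · rw [← h0, Real.zero_rpow (rt_expo_pos n).ne', Real.zero_rpow (rt_expo_pos k).ne']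
  · apply Real.rpow_le_rpow_of_exponent_ge h0 h1
    gcongr

theorem rt_le_one (n : ℕ) {a : B} (ha : 0 ≤ a) (h : ‖a‖ ≤ 1) : rt n a ≤ 1 := by
  apply cfc_le_one
  intro x hx
  obtain ⟨h0, h1⟩ := spec_le ha h hx
  exact Real.rpow_le_one h0 h1 (rt_expo_pos n).le

theorem rt_tendsto (n : ℕ) {x : ℕ → B} {a : B} (hx : ∀ j, 0 ≤ x j) (ha : 0 ≤ a)
    (h : Tendsto x atTop (𝓝 a)) : Tendsto (fun j => rt n (x j)) atTop (𝓝 (rt n a)) := by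
  have h1 : ∀ᶠ j in atTop, ‖x j‖ ≤ ‖a‖ + 1 := by
    have := h.norm.eventually_le_const (show ‖a‖ < ‖a‖ + 1 by linarith)
    exact this
  exact Filter.Tendsto.cfc (s := Set.Icc 0 (‖a‖+1)) isCompact_Icc _ h
    (h1.mono fun j hj => spec_le (hx j) hj) (Eventually.of_forall fun j => .of_nonneg (hx j))
    (spec_le ha (by linarith)) (.of_nonneg ha) (rt_cont n).continuousOn

/-- abstract dimension value -/
def dimA (T : B →ₗ[ℂ] ℂ) (a : B) : ℝ := limsup (fun n => (T (rt n a)).re) atTop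

variable {T : B →ₗ[ℂ] ℂ} (hT : ∀ x : B, 0 ≤ x → 0 ≤ T x)
include hT

theorem T_mono {x y : B} (h : x ≤ y) : (T x).re ≤ (T y).re := by
  have := hT (y - x) (sub_nonneg.2 h)
  rw [map_sub] at this
  have := (Complex.le_def.1 this).1
  simp at this
  exact this

theorem T_re_nonneg {x : B} (h : 0 ≤ x) : 0 ≤ (T x).re := by
  simpa using T_mono hT h

theorem dimA_contr {a : B} (ha : 0 ≤ a) (h : ‖a‖ ≤ 1) :
    Tendsto (fun n => (T (rt n a)).re) atTop (𝓝 (dimA T a)) ∧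
      ∀ n, (T (rt n a)).re ≤ dimA T a := by
  have hm : Monotone (fun n => (T (rt n a)).re) := fun n k hnk => T_mono hT (rt_succ n k hnk ha h)
  have hb : BddAbove (Set.range (fun n => (T (rt n a)).re)) :=
    ⟨(T 1).re, by rintro _ ⟨n, rfl⟩; exact T_mono hT (rt_le_one n ha h)⟩
  have ht := tendsto_atTop_ciSup hm hb
  have : dimA T a = ⨆ n, (T (rt n a)).re := ht.limsup_eq
  rw [this]
  exact ⟨ht, fun n => le_ciSup hb n⟩

omit hT in
theorem pow_expo_tendsto {s : ℝ} (hs : 0 < s) :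
    Tendsto (fun n : ℕ => s ^ ((n + 1 : ℝ)⁻¹)) atTop (𝓝 1) := by
  have h1 : Tendsto (fun n : ℕ => ((n + 1 : ℝ)⁻¹)) atTop (𝓝 0) := by
    simpa using tendsto_one_div_add_atTop_nhds_zero_nat (𝕜 := ℝ)
  have := (Real.continuous_const_rpow hs.ne').tendsto 0 |>.comp h1
  simpa [Function.comp_def] using this

omit hT in
theorem T_rsmul (s : ℝ) (x : B) : (T (s • x)).re = s * (T x).re := by
  have : s • x = (s : ℂ) • x := by simp
  rw [this, map_smul]; simp

theorem dimA_gen {a : B} (ha : 0 ≤ a) {S : ℝ} (hS : 0 < S) (h : ‖a‖ ≤ S) :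
    Tendsto (fun n => (T (rt n a)).re) atTop (𝓝 (dimA T a)) ∧
      ∀ n : ℕ, (T (rt n a)).re ≤ S ^ ((n + 1 : ℝ)⁻¹) * dimA T a := by
  have h1 : 0 ≤ S⁻¹ • a := smul_nonneg (inv_nonneg.2 hS.le) ha
  have h2 : ‖S⁻¹ • a‖ ≤ 1 := by
    rw [norm_smul, norm_inv, Real.norm_of_nonneg hS.le, inv_mul_le_iff₀ hS]; simpa using h
  obtain ⟨t, l⟩ := dimA_contr hT h1 h2
  have e : ∀ n, (T (rt n a)).re = S ^ ((n + 1 : ℝ)⁻¹) * (T (rt n (S⁻¹ • a))).re := by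
    intro n
    rw [← T_rsmul, ← rt_smul n h1 hS.le, smul_inv_smul₀ hS.ne']
  have t' := (pow_expo_tendsto hS).mul t
  simp only [← e, one_mul] at t'
  have e2 : dimA T a = dimA T (S⁻¹ • a) := t'.limsup_eq
  rw [e2]
  refine ⟨t', fun n => ?_⟩
  rw [e]
  gcongr
  exact l n

theorem dimA_tendsto {a : B} (ha : 0 ≤ a) :
    Tendsto (fun n => (T (rt n a)).re) atTop (𝓝 (dimA T a)) :=
  (dimA_gen hT ha (S := ‖a‖ + 1) (by positivity) (by linarith)).1

theorem dimA_pos {a : B} (ha : 0 ≤ a) (h : 0 < (T a).re) : 0 < dimA T a := by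
  have := (dimA_gen hT ha (S := ‖a‖ + 1) (by positivity) (by linarith)).2 0
  rw [rt_zero_idx ha] at this
  have h2 : (0:ℝ) < (‖a‖ + 1) ^ (((0:ℕ) + 1 : ℝ)⁻¹) := by positivity
  by_contra hc
  push Not at hc
  nlinarith

theorem T_cont : Continuous T := by
  let f : B →ₚ[ℂ] ℂ := PositiveLinearMap.mk₀ T hT
  have : Continuous f := map_continuous f
  exact this

end Abs


section Mat
variable {A : Type*} [CStarAlgebra A] [PartialOrder A] [StarOrderedRing A]
variable {m k : Type*} [Fintype m] [Fintype k] [DecidableEq m] [DecidableEq k]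

theorem posElem_iff {R : Type*} [CStarAlgebra R] [PartialOrder R] [StarOrderedRing R] {a : R} :
    IsPosElem a ↔ 0 ≤ a := by
  rw [CStarAlgebra.nonneg_iff_eq_star_mul_self]; rfl

theorem posM {a : Matrix m m A} : IsPosElem a ↔ 0 ≤ CStarMatrix.ofMatrix a :=
  posElem_iff (R := CStarMatrix m m A) (a := CStarMatrix.ofMatrix a)

def mrt (n : ℕ) (a : Matrix m m A) : Matrix m m A :=
  CStarMatrix.ofMatrix.symm (rt n (CStarMatrix.ofMatrix a))

theorem ofM_pow (a : Matrix m m A) (n : ℕ) :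
    CStarMatrix.ofMatrix (a ^ n) = (CStarMatrix.ofMatrix a) ^ n := rfl

theorem mrt_pos (n : ℕ) {a : Matrix m m A} (ha : IsPosElem a) : IsPosElem (mrt n a) :=
  posM.2 (rt_nonneg n (posM.1 ha))

theorem mrt_pow (n : ℕ) {a : Matrix m m A} (ha : IsPosElem a) : mrt n a ^ (n + 1) = a :=
  rt_pow (B := CStarMatrix m m A) n (posM.1 ha)

theorem mrt_unique (n : ℕ) {a b : Matrix m m A} (hb : IsPosElem b) (h : b ^ (n + 1) = a) :
    b = mrt n a :=
  rt_unique' (B := CStarMatrix m m A) n (posM.1 hb) h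

theorem root_eq (n : ℕ) {a : Matrix m m A} (ha : IsPosElem a) : matNthRoot a (n + 1) = mrt n a := by
  have h : ∃ b : Matrix m m A, IsPosElem b ∧ b ^ (n + 1) = a := ⟨mrt n a, mrt_pos n ha, mrt_pow n ha⟩
  rw [matNthRoot, dif_pos h]
  exact mrt_unique n h.choose_spec.1 h.choose_spec.2

/-- the trace functional on matrices -/
def TT (τ : A →ₗ[ℂ] ℂ) : CStarMatrix m m A →ₗ[ℂ] ℂ where
  toFun x := traceExt τ (CStarMatrix.ofMatrix.symm x)
  map_add' x y := by simp [traceExt, Finset.sum_add_distrib]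
  map_smul' c x := by simp [traceExt, Finset.mul_sum]

theorem traceExt_comm {R : Type*} [Ring R] [Module ℂ R] {m k : Type*} [Fintype m] [Fintype k]
    (τ : R →ₗ[ℂ] ℂ) (h : ∀ a b, τ (a * b) = τ (b * a))
    (x : Matrix m k R) (y : Matrix k m R) : traceExt τ (x * y) = traceExt τ (y * x) := by
  simp only [traceExt, Matrix.mul_apply, map_sum]
  rw [Finset.sum_comm]
  exact Finset.sum_congr rfl fun i _ => Finset.sum_congr rfl fun j _ => h _ _

theorem TT_pos {τ : A →ₗ[ℂ] ℂ} (hτ : IsTracialState τ) (x : CStarMatrix m m A) (hx : 0 ≤ x) :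
    0 ≤ TT τ x := by
  obtain ⟨y, hy⟩ := posElem_iff.2 hx
  have : TT τ x = ∑ i, ∑ j, τ (star (y j i) * y j i) := by
    rw [hy]
    simp only [TT, traceExt, LinearMap.coe_mk, AddHom.coe_mk, CStarMatrix.ofMatrix_symm_apply,
      CStarMatrix.mul_apply, CStarMatrix.star_apply, map_sum]
  rw [this]
  exact Finset.sum_nonneg fun i _ => Finset.sum_nonneg fun j _ => hτ.2.1 _

theorem dimFun_eq (τ : A →ₗ[ℂ] ℂ) {a : Matrix m m A} (ha : IsPosElem a) :
    dimFun τ a = dimA (TT τ) (CStarMatrix.ofMatrix a) := by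
  simp only [dimFun, dimA, root_eq _ ha]
  rfl

theorem dimFun_tendsto {τ : A →ₗ[ℂ] ℂ} (hτ : IsTracialState τ) {a : Matrix m m A}
    (ha : IsPosElem a) :
    Tendsto (fun n => (traceExt τ (mrt n a)).re) atTop (𝓝 (dimFun τ a)) := by
  rw [dimFun_eq τ ha]
  exact dimA_tendsto (TT_pos hτ) (posM.1 ha)

theorem dimFun_le {τ : A →ₗ[ℂ] ℂ} (hτ : IsTracialState τ) {a : Matrix m m A}
    (ha : IsPosElem a) {S : ℝ} (hS : 0 < S) (h : ‖CStarMatrix.ofMatrix a‖ ≤ S) (n : ℕ) :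
    (traceExt τ (mrt n a)).re ≤ S ^ ((n + 1 : ℝ)⁻¹) * dimFun τ a := by
  rw [dimFun_eq τ ha]
  exact (dimA_gen (TT_pos hτ) (posM.1 ha) hS h).2 n

theorem pos_blockDiagonal {o : Type*} [Fintype o] [DecidableEq o] {f : o → Matrix m m A}
    (hf : ∀ g, IsPosElem (f g)) : IsPosElem (Matrix.blockDiagonal f) := by
  choose y hy using hf
  refine ⟨Matrix.blockDiagonal y, ?_⟩
  rw [Matrix.star_eq_conjTranspose, Matrix.blockDiagonal_conjTranspose, ← Matrix.blockDiagonal_mul]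
  congr 1; ext1 g; exact hy g

theorem dimFun_blockDiagonal {o : Type*} [Fintype o] [DecidableEq o] {τ : A →ₗ[ℂ] ℂ}
    (hτ : IsTracialState τ) {f : o → Matrix m m A} (hf : ∀ g, IsPosElem (f g)) :
    dimFun τ (Matrix.blockDiagonal f) = ∑ g, dimFun τ (f g) := by
  have h1 := dimFun_tendsto hτ (pos_blockDiagonal hf)
  have h2 := tendsto_finset_sum Finset.univ fun g _ => dimFun_tendsto hτ (hf g)
  refine tendsto_nhds_unique h1 (h2.congr fun n => ?_)
  have : mrt n (Matrix.blockDiagonal f) = Matrix.blockDiagonal fun g => mrt n (f g) := by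
    symm
    apply mrt_unique n (pos_blockDiagonal fun g => mrt_pos n (hf g))
    rw [← Matrix.blockDiagonal_pow]
    congr 1; ext1 g; exact mrt_pow n (hf g)
  rw [this]
  simp only [traceExt, Fintype.sum_prod_type, Matrix.blockDiagonal_apply_eq, Complex.re_sum]
  rw [Finset.sum_comm]

theorem pow_swap {R : Type*} [Ring R] (x : Matrix m k R) (y : Matrix k m R) (i : ℕ) :
    (x * y) ^ i * x = x * (y * x) ^ i := by
  induction i with
  | zero => simp
  | succ i ih =>
    rw [pow_succ, pow_succ, Matrix.mul_assoc, Matrix.mul_assoc x y x, ← Matrix.mul_assoc _ x,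
      ih, Matrix.mul_assoc]

theorem TT_rs (τ : A →ₗ[ℂ] ℂ) (r : ℝ) (z : CStarMatrix m m A) :
      TT τ (r • z) = (r : ℂ) * TT τ z := by
  have : r • z = (r : ℂ) • z := by
    ext i j
    simp
  rw [this, map_smul, smul_eq_mul]

theorem T_poly {τ : A →ₗ[ℂ] ℂ} (hτ : IsTracialState τ) (x : Matrix m k A) (y : Matrix k m A)
    (Q : Polynomial ℝ) :
    TT τ (Polynomial.aeval (CStarMatrix.ofMatrix (x * y)) (Polynomial.X * Q)) =
    TT τ (Polynomial.aeval (CStarMatrix.ofMatrix (y * x)) (Polynomial.X * Q)) := by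
  have key : ∀ i : ℕ, TT τ (CStarMatrix.ofMatrix (x * y) * CStarMatrix.ofMatrix (x * y) ^ i) =
     TT τ (CStarMatrix.ofMatrix (y * x) * CStarMatrix.ofMatrix (y * x) ^ i) := by
    intro i
    change traceExt τ ((x * y) * (x * y) ^ i) = traceExt τ ((y * x) * (y * x) ^ i)
    rw [← pow_succ', pow_succ, ← Matrix.mul_assoc, pow_swap, Matrix.mul_assoc,
      traceExt_comm τ hτ.2.2, ← pow_succ', Matrix.mul_assoc, ← pow_succ]
  simp only [map_mul, Polynomial.aeval_X]
  rw [Polynomial.aeval_eq_sum_range, Polynomial.aeval_eq_sum_range, Finset.mul_sum, Finset.mul_sum,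
    map_sum, map_sum]
  refine Finset.sum_congr rfl fun i _ => ?_
  rw [mul_smul_comm, mul_smul_comm]
  rw [TT_rs, TT_rs, key i]

theorem pos_conj_self (y : Matrix k m A) : IsPosElem (y.conjTranspose * y) := by
  rw [posM]
  rcases isEmpty_or_nonempty m with hm | ⟨⟨i0⟩⟩
  · exact le_of_eq (by ext i; exact hm.elim i)
  let z : k → CStarMatrix m m A := fun r => CStarMatrix.ofMatrix fun i j => if i = i0 then y r j else 0
  have hz : ∀ r i j, z r i j = if i = i0 then y r j else 0 := fun _ _ _ => rfl
  have : CStarMatrix.ofMatrix (y.conjTranspose * y) = ∑ r, star (z r) * z r := by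
    ext i j
    have e : ∀ (f : k → CStarMatrix m m A), (∑ r, f r) i j = ∑ r, f r i j := by
      intro f
      exact Matrix.sum_apply i j Finset.univ f
    rw [e]
    change (y.conjTranspose * y) i j = _
    rw [Matrix.mul_apply]
    refine Finset.sum_congr rfl fun r _ => ?_
    rw [CStarMatrix.mul_apply, Finset.sum_eq_single i0]
    · rw [CStarMatrix.star_apply, hz, hz, if_pos rfl, if_pos rfl]; rfl
    · intro b _ hb
      rw [hz r b j, if_neg hb, mul_zero]
    · simp
  rw [this]
  exact Finset.sum_nonneg fun r _ => star_mul_self_nonneg _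

theorem pos_self_conj (x : Matrix m k A) : IsPosElem (x * x.conjTranspose) := by
  simpa using pos_conj_self x.conjTranspose

theorem tendsto_aeval_rt {C : Type*} [CStarAlgebra C] [PartialOrder C] [StarOrderedRing C] (c : C)
    (n : ℕ) (R : ℝ) (Q : ℕ → Polynomial ℝ) (hQ : ∀ j : ℕ, ∀ t ∈ Set.Icc 0 R,
      |(Polynomial.X * Q j).eval t - t ^ ((n + 1 : ℝ)⁻¹)| ≤ 2 * (1 / ((j : ℝ) + 1)))
    (hc : 0 ≤ c) (hcR : ‖c‖ ≤ R) :
    Tendsto (fun j => Polynomial.aeval c (Polynomial.X * Q j)) atTop (𝓝 (rt n c)) := by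
    have : ∀ j, Polynomial.aeval c (Polynomial.X * Q j) = cfc (Polynomial.X * Q j).eval c :=
      fun j => (cfc_polynomial _ c (.of_nonneg hc)).symm
    simp only [this]
    apply tendsto_cfc_fun
    · rw [Metric.tendstoUniformlyOn_iff]
      intro ε hε
      have h0 : Tendsto (fun j : ℕ => 2 * (1 / ((j : ℝ) + 1))) atTop (𝓝 0) := by
        simpa using (tendsto_one_div_add_atTop_nhds_zero_nat (𝕜 := ℝ)).const_mul 2
      filter_upwards [h0.eventually_lt_const hε] with j hj t ht
      rw [dist_comm, Real.dist_eq]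
      exact (hQ j t (spec_le hc hcR ht)).trans_lt hj
    · exact Eventually.of_forall fun j => (Polynomial.X * Q j).continuous.continuousOn

theorem trace_swap {τ : A →ₗ[ℂ] ℂ} (hτ : IsTracialState τ) (x : Matrix m k A) (n : ℕ) :
    traceExt τ (mrt n (x * x.conjTranspose)) = traceExt τ (mrt n (x.conjTranspose * x)) := by
  set p : CStarMatrix m m A := CStarMatrix.ofMatrix (x * x.conjTranspose) with hp
  set q : CStarMatrix k k A := CStarMatrix.ofMatrix (x.conjTranspose * x) with hq
  have hp0 : 0 ≤ p := posM.1 (pos_self_conj x)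
  have hq0 : 0 ≤ q := posM.1 (pos_conj_self x)
  change TT τ (rt n p) = TT τ (rt n q)
  let R := max ‖p‖ ‖q‖
  have hR : 0 ≤ R := (norm_nonneg p).trans (le_max_left _ _)
  have ex : ∀ j : ℕ, ∃ Q : Polynomial ℝ, ∀ t ∈ Set.Icc 0 R,
      |(Polynomial.X * Q).eval t - t ^ ((n + 1 : ℝ)⁻¹)| ≤ 2 * (1 / ((j : ℝ) + 1)) := by
    intro j
    obtain ⟨P, hP⟩ := exists_polynomial_near_of_continuousOn 0 R
      (fun t : ℝ => t ^ ((n + 1 : ℝ)⁻¹)) (rt_cont n).continuousOn (1 / ((j : ℝ) + 1)) (by positivity)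
    refine ⟨P.divX, fun t ht => ?_⟩
    have e : (Polynomial.X * P.divX).eval t = P.eval t - P.eval 0 := by
      have h := congrArg (Polynomial.eval t) (Polynomial.X_mul_divX_add P)
      rw [Polynomial.eval_add, Polynomial.eval_C, Polynomial.coeff_zero_eq_eval_zero] at h
      linarith
    have h1 := hP t ht
    have h2 := hP 0 ⟨le_rfl, hR⟩
    rw [Real.zero_rpow (rt_expo_pos n).ne', sub_zero] at h2
    rw [e]
    have : P.eval t - P.eval 0 - t ^ ((n + 1 : ℝ)⁻¹) = (P.eval t - t ^ ((n + 1 : ℝ)⁻¹)) - P.eval 0 := by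
      ring
    rw [this]
    exact (abs_sub _ _).trans (by linarith)
  choose Q hQ using ex
  have t1 := ((T_cont (TT_pos hτ)).tendsto _).comp (tendsto_aeval_rt p n R Q hQ hp0 (le_max_left _ _))
  have t2 := ((T_cont (TT_pos hτ)).tendsto _).comp (tendsto_aeval_rt q n R Q hQ hq0 (le_max_right _ _))
  refine tendsto_nhds_unique t1 (t2.congr fun j => ?_)
  exact (T_poly hτ x x.conjTranspose (Q j)).symm

end Mat


section Mat
variable {A : Type*} [CStarAlgebra A] [PartialOrder A] [StarOrderedRing A]
variable {m k : Type*} [Fintype m] [Fintype k] [DecidableEq m] [DecidableEq k]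

theorem dimFun_nonneg {τ : A →ₗ[ℂ] ℂ} (hτ : IsTracialState τ) {b : Matrix k k A}
    (hb : IsPosElem b) : 0 ≤ dimFun τ b :=
  ge_of_tendsto' (dimFun_tendsto hτ hb) fun n =>
    T_re_nonneg (TT_pos hτ) (posM.1 (mrt_pos n hb))

theorem pos_conj {b : Matrix k k A} (hb : IsPosElem b) (v : Matrix m k A) :
    IsPosElem (v * b * v.conjTranspose) := by
  obtain ⟨y, rfl⟩ := hb
  have := pos_self_conj (v * y.conjTranspose)
  rw [Matrix.conjTranspose_mul, Matrix.conjTranspose_conjTranspose] at this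
  rw [Matrix.star_eq_conjTranspose]
  simpa only [Matrix.mul_assoc] using this

theorem conj_bound {B : Type*} [CStarAlgebra B] [PartialOrder B] [StarOrderedRing B]
    {T : B →ₗ[ℂ] ℂ} (hT : ∀ x : B, 0 ≤ x → 0 ≤ T x) {S w b : B} (hw : 0 ≤ w)
    (hS : star S = S) (hSS : S * S = b) (hb : 0 ≤ b) (n : ℕ) :
    (T (rt n (star S * w * S))).re ≤ (‖w‖ + 1) ^ ((n + 1 : ℝ)⁻¹) * (T (rt n b)).re := by
  have hC : 0 < ‖w‖ + 1 := by positivity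
  have hle : star S * w * S ≤ (‖w‖ + 1) • b := by
    refine (CStarAlgebra.star_left_conjugate_le_norm_smul).trans ?_
    rw [hS, hSS]
    exact smul_le_smul_of_nonneg_right (by linarith) hb
  have := T_mono hT (rt_mono n (star_left_conjugate_nonneg hw S) hle)
  rwa [rt_smul n hb hC.le, T_rsmul] at this

theorem dim_conj {τ : A →ₗ[ℂ] ℂ} (hτ : IsTracialState τ) {b : Matrix k k A}
    (hb : IsPosElem b) (v : Matrix m k A) :
    dimFun τ (v * b * v.conjTranspose) ≤ dimFun τ b := by
  set s := mrt 1 b with hs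
  have hs0 : IsPosElem s := mrt_pos 1 hb
  have hss : s * s = b := by rw [← sq]; exact mrt_pow 1 hb
  have hsa : s.conjTranspose = s := by
    obtain ⟨y, hy⟩ := hs0
    rw [hy, Matrix.star_eq_conjTranspose]; simp
  set x := v * s with hx
  have e1 : v * b * v.conjTranspose = x * x.conjTranspose := by
    rw [hx, Matrix.conjTranspose_mul, hsa, ← hss]; simp only [Matrix.mul_assoc]
  let w : CStarMatrix k k A := CStarMatrix.ofMatrix (v.conjTranspose * v)
  have hw0 : 0 ≤ w := posM.1 (pos_conj_self v)
  let S : CStarMatrix k k A := CStarMatrix.ofMatrix s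
  have hS : star S = S := hsa
  have hSS : S * S = CStarMatrix.ofMatrix b := hss
  have e2 : CStarMatrix.ofMatrix (x.conjTranspose * x) = star S * w * S := by
    change x.conjTranspose * x = s.conjTranspose * (v.conjTranspose * v) * s
    rw [hx, Matrix.conjTranspose_mul]; simp only [Matrix.mul_assoc]
  have hC : 0 < ‖w‖ + 1 := by positivity
  have t1 := dimFun_tendsto hτ (pos_conj hb v)
  have t2 := (pow_expo_tendsto hC).mul (dimFun_tendsto hτ hb)
  rw [one_mul] at t2
  refine le_of_tendsto_of_tendsto' t1 t2 fun n => ?_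
  rw [e1, trace_swap hτ]
  have := conj_bound (TT_pos hτ) hw0 hS hSS (posM.1 hb) n
  rw [← e2] at this
  exact this

theorem dim_mono {τ : A →ₗ[ℂ] ℂ} (hτ : IsTracialState τ) {a : Matrix m m A} {b : Matrix k k A}
    (ha : IsPosElem a) (hb : IsPosElem b) (h : CuntzSub a b) : dimFun τ a ≤ dimFun τ b := by
  obtain ⟨v, hv⟩ := h
  have hv' : Tendsto (fun j => CStarMatrix.ofMatrix (v j * b * (v j).conjTranspose)) atTop
    (𝓝 (CStarMatrix.ofMatrix a)) := hv
  have hS : 0 < ‖CStarMatrix.ofMatrix a‖ + 1 := by positivity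
  have t2 := (pow_expo_tendsto hS).mul_const (dimFun τ b)
  rw [one_mul] at t2
  refine le_of_tendsto_of_tendsto' (dimFun_tendsto hτ ha) t2 fun n => ?_
  have t3 := rt_tendsto n (fun j => posM.1 (pos_conj hb (v j))) (posM.1 ha) hv'
  have t4 := (Complex.continuous_re.tendsto _).comp (((T_cont (TT_pos hτ)).tendsto _).comp t3)
  refine le_of_tendsto t4 ?_
  filter_upwards [hv'.norm.eventually_le_const (lt_add_one _)] with j hj
  refine (dimFun_le hτ (pos_conj hb (v j)) hS hj n).trans ?_
  gcongr
  exact dim_conj hτ hb _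

theorem faithful (hs : IsSimpleCStarAlgebra A) {τ : A →ₗ[ℂ] ℂ} (hτ : IsTracialState τ) {y : A}
    (hy : τ (star y * y) = 0) : y = 0 := by
  have hpos : ∀ x : A, 0 ≤ x → 0 ≤ τ x := by
    intro x hx
    obtain ⟨z, rfl⟩ := posElem_iff.2 hx
    exact hτ.2.1 z
  have hc := T_cont hpos
  let I : TwoSidedIdeal A := TwoSidedIdeal.mk' {x | ∀ z, τ (x * z) = 0}
    (by simp) (by intro x y hx hy z; simp only [Set.mem_setOf_eq] at *; rw [add_mul, map_add, hx, hy, add_zero])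
    (by intro x hx z; simp only [Set.mem_setOf_eq] at *; rw [neg_mul, map_neg, hx, neg_zero])
    (by
      intro x y hy z
      simp only [Set.mem_setOf_eq] at *
      rw [mul_assoc, hτ.2.2, mul_assoc]; exact hy _)
    (by
      intro x y hx z
      simp only [Set.mem_setOf_eq] at *
      rw [mul_assoc]; exact hx _)
  have memI : ∀ x, x ∈ I ↔ ∀ z, τ (x * z) = 0 := fun x => by
    simp [I, TwoSidedIdeal.mem_mk']
  have hcl : IsClosed (I : Set A) := by
    have : (I : Set A) = ⋂ z, {x | τ (x * z) = 0} := by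
      ext x; simp [memI]
    rw [this]
    exact isClosed_iInter fun z => isClosed_eq (hc.comp (continuous_id.mul continuous_const)) continuous_const
  have hyI : y ∈ I := by
    rw [memI]
    intro z
    -- Cauchy-Schwarz
    have key : ∀ (c : ℂ), 0 ≤ c * τ (z * y) + star c * τ (star y * star z) + τ (z * star z) := by
      intro c
      have h := hτ.2.1 (c • y + star z)
      have e : star (c • y + star z) * (c • y + star z) =
        (star c * c) • (star y * y) + c • (z * y) + star c • (star y * star z) + z * star z := by
        simp only [star_add, star_smul, star_star, add_mul, mul_add, smul_add, smul_smul, mul_comm c (star c), mul_smul_comm,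
          smul_mul_assoc]
        abel
      rw [e, map_add, map_add, map_add, map_smul, map_smul, map_smul, hy] at h
      simpa using h
    have hstar : τ (star y * star z) = star (τ (z * y)) := by
      have h1 := key 1
      have h2 := key Complex.I
      have h3 := hpos _ (mul_star_self_nonneg z)
      rw [Complex.le_def] at h1 h2 h3
      simp at h1 h2 h3
      apply Complex.ext <;> simp <;> linarith
    rw [hτ.2.2]
    set w := τ (z * y) with hw
    set D := (τ (z * star z)).re with hD
    have h := fun t : ℝ => (Complex.le_def.1 (key ((t : ℂ) * star w))).1
    simp only [hstar] at h
    have h' : ∀ t : ℝ, 0 ≤ 2 * t * Complex.normSq w + D := by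
      intro t
      have := h t
      simp [Complex.normSq_apply] at this ⊢
      linarith
    have hD0 : 0 ≤ D := by simpa using h' 0
    by_contra hne
    have hn : 0 < Complex.normSq w := Complex.normSq_pos.2 hne
    have := h' (-(D + 1) / Complex.normSq w)
    rw [show 2 * (-(D + 1) / Complex.normSq w) * Complex.normSq w = -2 * (D + 1) by field_simp] at this
    linarith
  rcases hs I hcl with h | h
  · rw [h] at hyI
    exact (TwoSidedIdeal.mem_bot _).1 hyI
  · exfalso
    have : (1 : A) ∈ I := by rw [h]; trivial
    have := (memI 1).1 this 1
    rw [mul_one, hτ.1] at this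
    exact one_ne_zero this

theorem dim_pos (hs : IsSimpleCStarAlgebra A) {τ : A →ₗ[ℂ] ℂ} (hτ : IsTracialState τ)
    {a : Matrix m m A} (ha : IsPosElem a) (hne : a ≠ 0) : 0 < dimFun τ a := by
  rw [dimFun_eq τ ha]
  refine dimA_pos (TT_pos hτ) (posM.1 ha) ?_
  have h0 := TT_pos hτ _ (posM.1 ha)
  obtain ⟨y, hy⟩ := ha
  have e : TT τ (CStarMatrix.ofMatrix a) = ∑ i, ∑ j, τ (star (y j i) * y j i) := by
    change traceExt τ a = _
    rw [hy]
    simp only [traceExt, Matrix.mul_apply, Matrix.star_apply, map_sum]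
  rcases h0.lt_or_eq with h | h
  · exact (Complex.lt_def.1 h).1
  exfalso
  apply hne
  rw [e] at h
  have hp : ∀ i j, 0 ≤ τ (star (y j i) * y j i) := fun i j => hτ.2.1 _
  have hy0 : y = 0 := by
    ext j i
    have h1 := (Finset.sum_eq_zero_iff_of_nonneg (fun i _ => Finset.sum_nonneg fun j _ => hp i j)).1 h.symm
      i (Finset.mem_univ _)
    have h2 := (Finset.sum_eq_zero_iff_of_nonneg (fun j _ => hp i j)).1 h1 j (Finset.mem_univ _)
    exact faithful hs hτ h2
  rw [hy, hy0, mul_zero]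

end Mat


section CS
variable {R : Type*} [Ring R] [StarRing R] [TopologicalSpace R]
variable {m k m' k' : Type*} [Fintype m] [Fintype k] [Fintype m'] [Fintype k']

theorem cs_left (e : m' ≃ m) {a : Matrix m m R} {b : Matrix k k R} (h : CuntzSub a b) :
    CuntzSub (a.submatrix e e) b := by
  obtain ⟨v, hv⟩ := h
  refine ⟨fun j => (v j).submatrix e id, ?_⟩
  have hc : Continuous fun x : Matrix m m R => x.submatrix e e := by fun_prop
  refine ((hc.tendsto a).comp hv).congr fun j => ?_
  ext p q
  simp [Matrix.mul_apply]

theorem cs_right (e : k' ≃ k) {a : Matrix m m R} {b : Matrix k k R} (h : CuntzSub a b) :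
    CuntzSub a (b.submatrix e e) := by
  obtain ⟨v, hv⟩ := h
  refine ⟨fun j => (v j).submatrix id e, ?_⟩
  refine hv.congr fun j => ?_
  rw [Matrix.conjTranspose_submatrix, Matrix.submatrix_mul_equiv, Matrix.submatrix_mul_equiv,
    Matrix.submatrix_id_id]

theorem cs_refl [DecidableEq m] (a : Matrix m m R) : CuntzSub a a :=
  ⟨fun _ => 1, by simpa using tendsto_const_nhds⟩

theorem posElem_submatrix (e : m' ≃ m) {a : Matrix m m R} (h : IsPosElem a) :
    IsPosElem (a.submatrix e e) := by
  obtain ⟨y, rfl⟩ := h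
  refine ⟨y.submatrix e e, ?_⟩
  rw [Matrix.star_eq_conjTranspose, Matrix.star_eq_conjTranspose, Matrix.conjTranspose_submatrix,
    Matrix.submatrix_mul_equiv]

theorem cs_map {S : Type*} [Ring S] [StarRing S] [TopologicalSpace S] (f : R →+* S)
    (hf : Continuous f) (hs : ∀ x, f (star x) = star (f x))
    {a : Matrix m m R} {b : Matrix k k R} (h : CuntzSub a b) : CuntzSub (a.map f) (b.map f) := by
  obtain ⟨v, hv⟩ := h
  refine ⟨fun j => (v j).map f, ?_⟩
  have hc : Continuous fun x : Matrix m m R => x.map f := by fun_prop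
  refine ((hc.tendsto a).comp hv).congr fun j => ?_
  simp only [Function.comp]
  rw [Matrix.map_mul, Matrix.map_mul]
  congr 1
  ext p q; simp [hs]

theorem pos_map {S : Type*} [Ring S] [StarRing S] (f : R →+* S)
    (hs : ∀ x, f (star x) = star (f x))
    {a : Matrix m m R} (h : IsPosElem a) : IsPosElem (a.map f) := by
  obtain ⟨y, rfl⟩ := h
  refine ⟨y.map f, ?_⟩
  rw [Matrix.map_mul]
  congr 1
  ext p q; simp [hs]

theorem blockDiag_submatrix {o : Type*} [DecidableEq o] (e : m' ≃ m) (c : o → Matrix m m R) :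
    (Matrix.blockDiagonal fun g => (c g).submatrix e e) =
    (Matrix.blockDiagonal c).submatrix (e.prodCongr (Equiv.refl o)) (e.prodCongr (Equiv.refl o)) := by
  ext ⟨i, g⟩ ⟨j, h⟩
  simp [Matrix.blockDiagonal_apply]

end CS

section CA
variable {A : Type*} [CStarAlgebra A] [PartialOrder A] [StarOrderedRing A]
variable {m k m' k' : Type*} [Fintype m] [Fintype k] [DecidableEq m] [DecidableEq k]
variable [Fintype m'] [DecidableEq m'] 

theorem dimFun_submatrix {τ : A →ₗ[ℂ] ℂ} (hτ : IsTracialState τ) (e : m' ≃ m) {a : Matrix m m A}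
    (ha : IsPosElem a) : dimFun τ (a.submatrix e e) = dimFun τ a :=
  le_antisymm (dim_mono hτ (posElem_submatrix e ha) ha (cs_left e (cs_refl a)))
    (dim_mono hτ ha (posElem_submatrix e ha) (cs_right e (cs_refl a)))

theorem sc_gen (h : HasStrictComparison A) {a : Matrix m m A} {b : Matrix k k A}
    (ha : IsPosElem a) (hb : IsPosElem b)
    (hd : ∀ τ : A →ₗ[ℂ] ℂ, IsTracialState τ → dimFun τ a < dimFun τ b) : CuntzSub a b := by
  let e := (Fintype.equivFin m).symm
  let f := (Fintype.equivFin k).symm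
  have h1 := h _ _ (a.submatrix e e) (b.submatrix f f) (posElem_submatrix e ha)
    (posElem_submatrix f hb) (fun τ hτ => by
      rw [dimFun_submatrix hτ e ha, dimFun_submatrix hτ f hb]; exact hd τ hτ)
  have h2 := cs_left e.symm (cs_right f.symm h1)
  simpa [Matrix.submatrix_submatrix] using h2

theorem cs_of_approx {R : Type*} [NormedRing R] [StarRing R] {a : Matrix m m R} {b : Matrix k k R}
    (h : ∀ ε : ℝ, 0 < ε → ∃ w : Matrix m k R, ∀ p q, ‖(w * b * w.conjTranspose) p q - a p q‖ < ε) :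
    CuntzSub a b := by
  choose! w hw using h
  refine ⟨fun j => w (1 / ((j : ℝ) + 1)), ?_⟩
  refine tendsto_pi_nhds.2 fun p => tendsto_pi_nhds.2 fun q => ?_
  rw [tendsto_iff_norm_sub_tendsto_zero]
  refine squeeze_zero (fun _ => norm_nonneg _) (fun j => (hw _ (by positivity) p q).le)
    (tendsto_one_div_add_atTop_nhds_zero_nat (𝕜 := ℝ))

end CA


section Asy
variable {A : Type*} [CStarAlgebra A]

def SBd (x : ℕ → A) : Prop := ∃ M : ℝ, ∀ k, ‖x k‖ ≤ M
def SEq (x y : ℕ → A) : Prop := Tendsto (fun k => x k - y k) atTop (𝓝 0)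

theorem SBd.const (a : A) : SBd fun _ => a := ⟨‖a‖, fun _ => le_rfl⟩

theorem SBd.mul {x y : ℕ → A} (hx : SBd x) (hy : SBd y) : SBd fun k => x k * y k := by
  obtain ⟨M, hM⟩ := hx
  obtain ⟨N, hN⟩ := hy
  exact ⟨M * N, fun k => (norm_mul_le _ _).trans
    (mul_le_mul (hM k) (hN k) (norm_nonneg _) ((norm_nonneg _).trans (hM k)))⟩

theorem SBd.sum {ι : Type*} (s : Finset ι) {x : ι → ℕ → A} (hx : ∀ i, SBd (x i)) :
    SBd fun k => ∑ i ∈ s, x i k := by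
  choose M hM using hx
  exact ⟨∑ i ∈ s, M i, fun k => norm_sum_le_of_le _ fun i _ => hM i k⟩

theorem SBd.star {x : ℕ → A} (hx : SBd x) : SBd fun k => star (x k) := by
  obtain ⟨M, hM⟩ := hx
  exact ⟨M, fun k => by rw [norm_star]; exact hM k⟩

theorem SBd.map {x : ℕ → A} (hx : SBd x) (f : A →⋆ₐ[ℂ] A) : SBd fun k => f (x k) := by
  obtain ⟨M, hM⟩ := hx
  exact ⟨M, fun k => (NonUnitalStarAlgHom.norm_apply_le f (x k)).trans (hM k)⟩

theorem SEq.refl (x : ℕ → A) : SEq x x := by simp [SEq]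

theorem SEq.symm {x y : ℕ → A} (h : SEq x y) : SEq y x := by
  simpa [SEq] using h.neg

theorem SEq.trans {x y z : ℕ → A} (h : SEq x y) (h' : SEq y z) : SEq x z := by
  simpa [SEq] using h.add h'

theorem SEq.add {x y x' y' : ℕ → A} (h : SEq x y) (h' : SEq x' y') :
    SEq (fun k => x k + x' k) (fun k => y k + y' k) := by
  have := Tendsto.add h h'
  rw [add_zero] at this
  refine this.congr fun k => ?_
  exact (add_sub_add_comm _ _ _ _).symm

theorem SEq.sum {ι : Type*} (s : Finset ι) {x y : ι → ℕ → A} (h : ∀ i ∈ s, SEq (x i) (y i)) :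
    SEq (fun k => ∑ i ∈ s, x i k) (fun k => ∑ i ∈ s, y i k) := by
  have := tendsto_finsetSum s h
  rw [Finset.sum_const_zero] at this
  exact this.congr fun k => by rw [Finset.sum_sub_distrib]

theorem SEq.mul_left {x y z : ℕ → A} (h : SEq x y) (hz : SBd z) :
    SEq (fun k => z k * x k) (fun k => z k * y k) := by
  obtain ⟨M, hM⟩ := hz
  have := (tendsto_zero_iff_norm_tendsto_zero.1 h).const_mul M
  rw [mul_zero] at this
  refine squeeze_zero_norm (fun k => ?_) this
  rw [← mul_sub]
  exact (norm_mul_le _ _).trans (mul_le_mul_of_nonneg_right (hM k) (norm_nonneg _))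

theorem SEq.mul_right {x y z : ℕ → A} (h : SEq x y) (hz : SBd z) :
    SEq (fun k => x k * z k) (fun k => y k * z k) := by
  obtain ⟨M, hM⟩ := hz
  have := (tendsto_zero_iff_norm_tendsto_zero.1 h).mul_const M
  rw [zero_mul] at this
  refine squeeze_zero_norm (fun k => ?_) this
  rw [← sub_mul]
  exact (norm_mul_le _ _).trans (mul_le_mul_of_nonneg_left (hM k) (norm_nonneg _))

theorem SEq.mul {x y x' y' : ℕ → A} (h : SEq x y) (h' : SEq x' y') (hx : SBd x) (hy' : SBd y') :
    SEq (fun k => x k * x' k) (fun k => y k * y' k) :=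
  (h'.mul_left hx).trans (h.mul_right hy')

theorem SEq.star {x y : ℕ → A} (h : SEq x y) : SEq (fun k => star (x k)) (fun k => star (y k)) := by
  have : Tendsto (fun k => Star.star (x k - y k)) atTop (𝓝 (Star.star 0)) :=
    (continuous_star.tendsto _).comp h
  simpa [SEq] using this

theorem SEq.map {x y : ℕ → A} (h : SEq x y) (f : A →⋆ₐ[ℂ] A) :
    SEq (fun k => f (x k)) (fun k => f (y k)) := by
  refine squeeze_zero_norm (fun k => ?_) (tendsto_zero_iff_norm_tendsto_zero.1 h)
  rw [← map_sub]
  exact NonUnitalStarAlgHom.norm_apply_le f _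

theorem SEq.of_norm {x y : ℕ → A} (h : Tendsto (fun k => ‖x k - y k‖) atTop (𝓝 0)) : SEq x y :=
  tendsto_zero_iff_norm_tendsto_zero.2 h

variable {G : Type*} [Group G] [Fintype G] [DecidableEq G]

structure Rok (α : G → (A →⋆ₐ[ℂ] A)) (e : G → ℕ → A) : Prop where
  bd : ∀ g, SBd (e g)
  idem : ∀ g, SEq (fun k => e g k * e g k) (e g)
  sa : ∀ g, SEq (fun k => star (e g k)) (e g)
  comm : ∀ g (a : A), SEq (fun k => e g k * a) (fun k => a * e g k)
  one : SEq (fun k => ∑ g, e g k) (fun _ => 1)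
  act : ∀ g h, SEq (fun k => α g (e h k)) (e (g * h))

theorem rok_of {α : G → (A →⋆ₐ[ℂ] A)} (h : ActionHasRokhlin α) : ∃ e, Rok α e := by
  obtain ⟨e, h1, h2, h3, h4, h5, h6⟩ := h
  exact ⟨e, h1, fun g => .of_norm (h2 g), fun g => .of_norm (h3 g), fun g a => .of_norm (h4 g a),
    .of_norm h5, fun g k => .of_norm (h6 g k)⟩

variable {α : G → (A →⋆ₐ[ℂ] A)} {e : G → ℕ → A}

theorem Rok.orth (R : Rok α e) {g h : G} (hgh : g ≠ h) :
    SEq (fun k => e g k * e h k) (fun _ => 0) := by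
  letI := CStarAlgebra.spectralOrder A
  haveI := CStarAlgebra.spectralOrderedRing A
  -- star (e g e h) (e g e h) ~ e h e g e h
  have h1 : ∀ g, SEq (fun k => star (e g k * e h k) * (e g k * e h k)) (fun k => e h k * e g k * e h k) := by
    intro g
    have a1 : SEq (fun k => star (e g k * e h k)) (fun k => e h k * e g k) := by
      simp only [star_mul]
      exact (R.sa h).mul (R.sa g) (R.bd h).star (R.bd g)
    have a2 := a1.mul_right ((R.bd g).mul (R.bd h))
    have a3 := ((R.idem g).mul_left (R.bd h)).mul_right (R.bd h)
    refine a2.trans ?_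
    simpa only [mul_assoc] using a3
  -- sum over all g
  have h2 : SEq (fun k => ∑ g, star (e g k * e h k) * (e g k * e h k)) (fun k => e h k) := by
    refine (SEq.sum _ fun g _ => h1 g).trans ?_
    have a1 := (R.one.mul_left (R.bd h)).mul_right (R.bd h)
    simp only [mul_one, Finset.mul_sum, Finset.sum_mul] at a1
    exact a1.trans (R.idem h)
  have h3 : SEq (fun k => star (e h k * e h k) * (e h k * e h k)) (fun k => e h k) := by
    refine (h1 h).trans ?_
    exact ((R.idem h).mul_right (R.bd h)).trans (R.idem h)
  have h4 := h2.trans h3.symm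
  have h5 : Tendsto (fun k => ∑ g ∈ Finset.univ.erase h, star (e g k * e h k) * (e g k * e h k))
      atTop (𝓝 0) := by
    refine Tendsto.congr (fun k => ?_) h4
    beta_reduce
    rw [← Finset.add_sum_erase _ _ (Finset.mem_univ h), add_sub_cancel_left]
  have h6 := (tendsto_zero_iff_norm_tendsto_zero.1 h5).sqrt
  rw [Real.sqrt_zero] at h6
  unfold SEq
  simp only [sub_zero]
  refine squeeze_zero_norm (fun k => ?_) h6
  apply Real.le_sqrt_of_sq_le
  rw [sq, ← CStarRing.norm_star_mul_self]
  apply CStarAlgebra.norm_le_norm_of_nonneg_of_le (star_mul_self_nonneg _)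
  exact Finset.single_le_sum (f := fun g => star (e g k * e h k) * (e g k * e h k))
    (fun i _ => star_mul_self_nonneg _) (Finset.mem_erase.2 ⟨hgh, Finset.mem_univ g⟩)

def bet (α : G → (A →⋆ₐ[ℂ] A)) (e : G → ℕ → A) (x : A) (s : ℕ) : A := ∑ g, α g (e 1 s * x)

theorem bet_add (x y : A) (s : ℕ) : bet α e (x + y) s = bet α e x s + bet α e y s := by
  simp [bet, mul_add, Finset.sum_add_distrib]

theorem bet_sum {ι : Type*} (t : Finset ι) (x : ι → A) (s : ℕ) :
    bet α e (∑ i ∈ t, x i) s = ∑ i ∈ t, bet α e (x i) s := by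
  simp only [bet, Finset.mul_sum, map_sum]
  rw [Finset.sum_comm]

theorem bet_mem (hact : IsGroupAction α) (x : A) (s : ℕ) : bet α e x s ∈ fixedPointAlgebra α := by
  intro g
  simp only [bet, map_sum, hact.2]
  exact Fintype.sum_equiv (Equiv.mulLeft g) _ _ fun h => rfl

theorem Rok.bet_bd (R : Rok α e) : ∃ M : ℝ, 0 < M ∧ ∀ x s, ‖bet α e x s‖ ≤ M * ‖x‖ := by
  obtain ⟨M, hM⟩ := R.bd 1
  have hM0 : 0 ≤ M := (norm_nonneg _).trans (hM 0)
  refine ⟨Fintype.card G * M + 1, by positivity, fun x s => ?_⟩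
  have : ‖bet α e x s‖ ≤ ∑ g : G, M * ‖x‖ := norm_sum_le_of_le _ fun g _ =>
    (NonUnitalStarAlgHom.norm_apply_le (α g) _).trans ((norm_mul_le _ _).trans
      (mul_le_mul_of_nonneg_right (hM s) (norm_nonneg _)))
  rw [Finset.sum_const, Finset.card_univ, nsmul_eq_mul] at this
  nlinarith [norm_nonneg x]

theorem Rok.bet_eq (R : Rok α e) (x : A) :
    SEq (bet α e x) (fun s => ∑ g, e g s * α g x) := by
  refine SEq.sum _ fun g _ => ?_
  simp only [map_mul]
  have := (R.act g 1).mul_right (SBd.const (α g x))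
  simpa using this

theorem Rok.bet_fix (R : Rok α e) {x : A} (hx : x ∈ fixedPointAlgebra α) :
    SEq (bet α e x) (fun _ => x) := by
  refine (R.bet_eq x).trans ?_
  have := R.one.mul_right (SBd.const x)
  simp only [one_mul, Finset.sum_mul] at this
  simpa only [hx _] using this

theorem Rok.bet_sBd (R : Rok α e) (x : A) : SBd (bet α e x) := by
  obtain ⟨M, _, h⟩ := R.bet_bd
  exact ⟨_, h x⟩

theorem Rok.bet_star (R : Rok α e) (x : A) :
    SEq (fun s => star (bet α e x s)) (bet α e (star x)) := by
  refine (R.bet_eq x).star.trans (SEq.trans ?_ (R.bet_eq (star x)).symm)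
  simp only [star_sum, star_mul]
  refine SEq.sum _ fun g _ => ?_
  refine ((R.sa g).mul_left (SBd.const _)).trans ?_
  rw [map_star]
  exact (R.comm g _).symm

theorem Rok.bet_mul (R : Rok α e) (x y : A) :
    SEq (fun s => bet α e x s * bet α e y s) (bet α e (x * y)) := by
  have b : ∀ x : A, SBd fun s => ∑ g, e g s * α g x := fun x =>
    SBd.sum _ fun g => (R.bd g).mul (.const _)
  have z1 := (R.bet_eq x).mul (R.bet_eq y) (R.bet_sBd x) (b y)
  have z2 := (R.bet_eq (x * y)).symm
  refine z1.trans (SEq.trans ?_ z2)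
  clear z1 z2
  simp only [Finset.sum_mul_sum]
  refine SEq.sum _ fun g _ => ?_
  have key : ∀ h, SEq (fun k => e g k * α g x * (e h k * α h y))
      (fun k => e g k * e h k * (α g x * α h y)) := by
    intro h
    have := ((R.comm h (α g x)).symm.mul_left (R.bd g)).mul_right (SBd.const (α h y))
    simpa only [mul_assoc] using this
  have k2 : ∀ h, SEq (fun k => e g k * α g x * (e h k * α h y))
      (fun k => if h = g then e g k * α g (x * y) else 0) := by
    intro h
    refine (key h).trans ?_
    by_cases hh : h = g
    · subst hh
      simp only [if_true, map_mul]
      exact (R.idem h).mul_right (SBd.const _)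
    · simp only [hh, if_false]
      have := (R.orth (Ne.symm hh)).mul_right (SBd.const (α g x * α h y))
      simpa using this
  refine (SEq.sum Finset.univ fun h _ => k2 h).trans ?_
  simp only [Finset.sum_ite_eq', Finset.mem_univ, if_true]
  exact SEq.refl _

end Asy


section Fix
variable {A : Type*} [CStarAlgebra A] 
variable {G : Type*} [Group G] [Fintype G] [DecidableEq G]
variable {α : G → (A →⋆ₐ[ℂ] A)} {e : G → ℕ → A}
variable {m k l : Type*} [Fintype m] [Fintype k] [Fintype l] [DecidableEq m] [DecidableEq k] [DecidableEq l]

def vmap (a : Matrix m k (fixedPointAlgebra α)) : Matrix m k A := a.map fun x => (x : A)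

theorem vmap_apply (a : Matrix m k (fixedPointAlgebra α)) (i : m) (j : k) :
    vmap a i j = (a i j : A) := rfl

theorem vmap_mul (a : Matrix m k (fixedPointAlgebra α)) (b : Matrix k l (fixedPointAlgebra α)) :
    vmap (a * b) = vmap a * vmap b := by
  ext i j
  simp [vmap, Matrix.mul_apply]

theorem vmap_conj (a : Matrix m k (fixedPointAlgebra α)) :
    vmap a.conjTranspose = (vmap a).conjTranspose := by
  ext i j
  simp [vmap]

theorem vmap_inj {a b : Matrix m k (fixedPointAlgebra α)} (h : vmap a = vmap b) : a = b := by
  ext i j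
  exact congrFun (congrFun h i) j

theorem vmap_one : vmap (1 : Matrix m m (fixedPointAlgebra α)) = 1 := by
  ext i j
  by_cases h : i = j <;> simp [vmap, Matrix.one_apply, h]

theorem vmap_pow (a : Matrix m m (fixedPointAlgebra α)) (n : ℕ) : vmap (a ^ n) = vmap a ^ n := by
  induction n with
  | zero => simp [vmap_one]
  | succ n ih => rw [pow_succ, pow_succ, vmap_mul, ih]

theorem vmap_pos {a : Matrix m m (fixedPointAlgebra α)} (h : IsPosElem a) : IsPosElem (vmap a) := by
  obtain ⟨y, rfl⟩ := h
  exact ⟨vmap y, by rw [vmap_mul, Matrix.star_eq_conjTranspose, vmap_conj]; rfl⟩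

theorem vmap_fix (a : Matrix m k (fixedPointAlgebra α)) (g : G) : (vmap a).map (α g) = vmap a := by
  ext i j
  exact (a i j).2 g

theorem vlift {a : Matrix m k A} (h : ∀ g, a.map (α g) = a) :
    ∃ b : Matrix m k (fixedPointAlgebra α), vmap b = a :=
  ⟨fun i j => ⟨a i j, fun g => congrFun (congrFun (h g) i) j⟩, rfl⟩

theorem map_pow' (f : A →⋆ₐ[ℂ] A) (a : Matrix m m A) (n : ℕ) : (a ^ n).map f = (a.map f) ^ n := by
  induction n with
  | zero => ext i j; by_cases h : i = j <;> simp [h]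
  | succ n ih => rw [pow_succ, pow_succ, Matrix.map_mul, ih]

theorem pos_map' (f : A →⋆ₐ[ℂ] A) {a : Matrix m m A} (h : IsPosElem a) : IsPosElem (a.map f) :=
  pos_map (f : A →+* A) (fun x => map_star f x) h

theorem cs_map' (f : A →⋆ₐ[ℂ] A) {a : Matrix m m A} {b : Matrix k k A} (h : CuntzSub a b) :
    CuntzSub (a.map f) (b.map f) :=
  cs_map (f : A →+* A) (AddMonoidHomClass.continuous_of_bound f 1 fun x => by
    rw [one_mul]; exact NonUnitalStarAlgHom.norm_apply_le f x) (fun x => map_star f x) h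

section ord
variable [PartialOrder A] [StarOrderedRing A]

theorem mrt_lift (n : ℕ) {a : Matrix m m (fixedPointAlgebra α)} (h : IsPosElem (vmap a)) :
    ∃ b : Matrix m m (fixedPointAlgebra α), vmap b = mrt n (vmap a) := by
  refine vlift fun g => ?_
  apply mrt_unique n (pos_map' (α g) (mrt_pos n h))
  rw [← map_pow', mrt_pow n h, vmap_fix]

theorem pos_sa {a : Matrix m m A} (h : IsPosElem a) : a.conjTranspose = a := by
  obtain ⟨y, hy⟩ := h
  rw [hy, Matrix.star_eq_conjTranspose]; simp

theorem pos_of_vmap {a : Matrix m m (fixedPointAlgebra α)} (h : IsPosElem (vmap a)) :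
    IsPosElem a := by
  obtain ⟨b, hb⟩ := mrt_lift 1 h
  refine ⟨b, vmap_inj ?_⟩
  rw [vmap_mul, Matrix.star_eq_conjTranspose, vmap_conj, hb, pos_sa (mrt_pos 1 h), ← sq]
  exact (mrt_pow 1 h).symm

theorem dimFun_res (τ : A →ₗ[ℂ] ℂ) (τ' : fixedPointAlgebra α →ₗ[ℂ] ℂ) (hτ : ∀ x, τ' x = τ (x : A))
    {a : Matrix m m (fixedPointAlgebra α)} (h : IsPosElem a) : dimFun τ' a = dimFun τ (vmap a) := by
  have hv := vmap_pos h
  simp only [dimFun]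
  congr 1
  ext n
  have ex : ∃ b : Matrix m m (fixedPointAlgebra α), IsPosElem b ∧ b ^ (n + 1) = a := by
    obtain ⟨b, hb⟩ := mrt_lift n hv
    refine ⟨b, pos_of_vmap (by rw [hb]; exact mrt_pos n hv), vmap_inj ?_⟩
    rw [vmap_pow, hb, mrt_pow n hv]
  rw [root_eq n hv]
  have e1 : vmap (matNthRoot a (n + 1)) = mrt n (vmap a) := by
    rw [matNthRoot, dif_pos ex]
    apply mrt_unique n (vmap_pos ex.choose_spec.1)
    rw [← vmap_pow, ex.choose_spec.2]
  rw [← e1]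
  simp only [traceExt, hτ]
  rfl

end ord

theorem transfer (hact : IsGroupAction α) (R : Rok α e) {a : Matrix m m (fixedPointAlgebra α)}
    {b : Matrix k k (fixedPointAlgebra α)} (h : CuntzSub (vmap a) (vmap b)) : CuntzSub a b := by
  obtain ⟨v, hv⟩ := h
  obtain ⟨M, hM0, hM⟩ := R.bet_bd
  apply cs_of_approx
  intro ε hε
  have hδ : 0 < ε / (2 * M) := by positivity
  have hev : ∀ᶠ j in atTop, ∀ p q, ‖(v j * vmap b * (v j).conjTranspose) p q - vmap a p q‖ < ε / (2 * M) := by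
    rw [eventually_all]; intro p
    rw [eventually_all]; intro q
    have := tendsto_pi_nhds.1 (tendsto_pi_nhds.1 hv p) q
    rw [tendsto_iff_norm_sub_tendsto_zero] at this
    exact this.eventually_lt_const hδ
  obtain ⟨j, hj⟩ := hev.exists
  set w := v j with hw
  let W : ℕ → Matrix m k (fixedPointAlgebra α) := fun s p q => ⟨bet α e (w p q) s, bet_mem hact _ _⟩
  have hW : ∀ s p q, vmap (W s) p q = bet α e (w p q) s := fun _ _ _ => rfl
  -- asymptotics
  have key : ∀ p q, SEq (fun s => (vmap (W s) * vmap b * (vmap (W s)).conjTranspose) p q)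
      (bet α e ((w * vmap b * w.conjTranspose) p q)) := by
    intro p q
    have e1 : (bet α e ((w * vmap b * w.conjTranspose) p q)) =
      fun s => ∑ x, ∑ y, bet α e (w p y * vmap b y x * star (w q x)) s := by
      ext s
      simp only [Matrix.mul_apply, Finset.sum_mul, bet_sum, Matrix.conjTranspose_apply]
    rw [e1]
    simp only [Matrix.mul_apply, Finset.sum_mul, Matrix.conjTranspose_apply, hW]
    refine SEq.sum _ fun x _ => SEq.sum _ fun y _ => ?_
    have s1 : SEq (fun s => bet α e (w p y) s * vmap b y x) (bet α e (w p y * vmap b y x)) :=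
      (((R.bet_fix (b y x).2).symm).mul_left (R.bet_sBd (w p y))).trans (R.bet_mul _ _)
    have s2 := s1.mul (R.bet_star (w q x)) ((R.bet_sBd (w p y)).mul (SBd.const _)) (R.bet_sBd _)
    exact s2.trans (R.bet_mul _ _)
  have ev2 : ∀ᶠ s in atTop, ∀ p q, ‖(vmap (W s) * vmap b * (vmap (W s)).conjTranspose) p q
      - bet α e ((w * vmap b * w.conjTranspose) p q) s + (bet α e (vmap a p q) s - vmap a p q)‖ < ε / 2 := by
    rw [eventually_all]; intro p
    rw [eventually_all]; intro q
    have t := (Tendsto.add (key p q) (R.bet_fix (a p q).2)).norm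
    rw [add_zero, norm_zero] at t
    exact t.eventually_lt_const (by positivity)
  obtain ⟨s, hs⟩ := ev2.exists
  refine ⟨W s, fun p q => ?_⟩
  have e3 : ‖(W s * b * (W s).conjTranspose) p q - a p q‖ =
      ‖(vmap (W s) * vmap b * (vmap (W s)).conjTranspose) p q - vmap a p q‖ := by
    rw [← vmap_conj, ← vmap_mul, ← vmap_mul]; rfl
  rw [e3]
  have h1 := hs p q
  set X := (vmap (W s) * vmap b * (vmap (W s)).conjTranspose) p q
  set Y := (w * vmap b * w.conjTranspose) p q with hY
  have h2 : bet α e Y s = bet α e (vmap a p q) s + bet α e (Y - vmap a p q) s := by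
    rw [← bet_add]; congr 1; abel
  have h3 := hM (Y - vmap a p q) s
  have h4 : M * ‖Y - vmap a p q‖ < ε / 2 := by
    have := mul_lt_mul_of_pos_left (hj p q) hM0
    rw [show M * (ε / (2 * M)) = ε / 2 by field_simp] at this
    exact this
  have e5 : X - vmap a p q = (X - bet α e Y s + (bet α e (vmap a p q) s - vmap a p q)) +
      bet α e (Y - vmap a p q) s := by
    rw [h2]; abel
  rw [e5]
  refine (norm_add_le _ _).trans_lt ?_
  linarith

theorem strict_fix [PartialOrder A] [StarOrderedRing A] (hact : IsGroupAction α) (R : Rok α e)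
    (h : HasStrictComparison A) : HasStrictComparison (fixedPointAlgebra α) := by
  intro m k a b ha hb hd
  refine transfer hact R (h m k _ _ (vmap_pos ha) (vmap_pos hb) fun τ hτ => ?_)
  let τ' : fixedPointAlgebra α →ₗ[ℂ] ℂ := τ ∘ₗ (fixedPointAlgebra α).subtype.toAlgHom.toLinearMap
  have e : ∀ x, τ' x = τ (x : A) := fun _ => rfl
  have := hd τ' ⟨by rw [e]; exact hτ.1, fun x => hτ.2.1 (x : A), fun x y => hτ.2.2 (x : A) y⟩
  rwa [dimFun_res τ τ' e ha, dimFun_res τ τ' e hb] at this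

end Fix


section Div
variable {A : Type*} [CStarAlgebra A] [PartialOrder A] [StarOrderedRing A]
variable {G : Type*} [Group G] [Fintype G] [DecidableEq G]
variable {α : G → (A →⋆ₐ[ℂ] A)} {e : G → ℕ → A}
variable {m k l : Type*} [Fintype m] [Fintype k] [Fintype l] [DecidableEq m] [DecidableEq k] [DecidableEq l]

theorem rok_inv (R : Rok α e) : ∃ (s : ℕ) (Y : Matrix G G A),
    (Matrix.of fun g h => α g (e h s)) * Y = 1 := by
  let V : ℕ → Matrix G G A := fun s => Matrix.of fun g h => α g (e h s)
  have hV : ∀ s g h, V s g h = α g (e h s) := fun _ _ _ => rfl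
  have key : ∀ g g', SEq (fun s => (V s * (V s).conjTranspose) g g')
      (fun _ => (1 : Matrix G G A) g g') := by
    intro g g'
    simp only [Matrix.mul_apply, Matrix.conjTranspose_apply, hV]
    have s1 : SEq (fun s => ∑ h, α g (e h s) * star (α g' (e h s)))
        (fun s => ∑ h, e (g * h) s * e (g' * h) s) := by
      refine SEq.sum _ fun h _ => ?_
      refine (R.act g h).mul ((R.act g' h).star.trans (R.sa _)) ((R.bd h).map _) (R.bd _)
    refine s1.trans ?_
    by_cases hg : g = g'
    · subst hg
      simp only [Matrix.one_apply_eq]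
      refine (SEq.sum _ fun h _ => R.idem (g * h)).trans ?_
      have : (fun s => ∑ h, e (g * h) s) = fun s => ∑ h, e h s := by
        ext s
        exact Fintype.sum_equiv (Equiv.mulLeft g) _ _ fun h => rfl
      rw [this]
      exact R.one
    · simp only [Matrix.one_apply_ne hg]
      have := SEq.sum Finset.univ fun (h : G) _ =>
        R.orth (g := g * h) (h := g' * h) (fun hh => hg (mul_right_cancel hh))
      simpa using this
  have t : Tendsto (fun s => V s * (V s).conjTranspose) atTop (𝓝 (1 : Matrix G G A)) := by
    refine tendsto_pi_nhds.2 fun g => tendsto_pi_nhds.2 fun g' => ?_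
    have := Tendsto.add_const ((1 : Matrix G G A) g g') (key g g')
    simpa using this
  have t' : Tendsto (fun s => CStarMatrix.ofMatrix (V s * (V s).conjTranspose)) atTop
    (𝓝 (1 : CStarMatrix G G A)) := t
  have hu := t'.eventually (Units.isOpen.mem_nhds isUnit_one)
  obtain ⟨s, u, hs⟩ := hu.exists
  refine ⟨s, (V s).conjTranspose * CStarMatrix.ofMatrix.symm (↑u⁻¹ : CStarMatrix G G A), ?_⟩
  rw [← Matrix.mul_assoc]
  have h2 : (u : CStarMatrix G G A) * (↑u⁻¹ : CStarMatrix G G A) = 1 := u.mul_inv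
  rw [hs] at h2
  exact h2

theorem build (hact : IsGroupAction α) (R : Rok α e) {c : Matrix l l A} (hc : IsPosElem c) :
    ∃ x : Matrix (G × l) (G × l) (fixedPointAlgebra α), IsPosElem x ∧
      ∀ τ : A →ₗ[ℂ] ℂ, IsTracialState τ → dimFun τ (vmap x) = ∑ g, dimFun τ (c.map (α g)) := by
  obtain ⟨s, Y, hY⟩ := rok_inv R
  set V : Matrix G G A := Matrix.of fun g h => α g (e h s) with hVdef
  have hV : ∀ g h, V g h = α g (e h s) := fun _ _ => rfl
  let U : Matrix (G × l) (G × l) A := Matrix.blockDiagonal fun _ : l => V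
  let W : Matrix (G × l) (G × l) A := Matrix.blockDiagonal fun _ : l => Y
  have hUW : U * W = 1 := by
    rw [← Matrix.blockDiagonal_mul]
    simp only [hY]
    exact Matrix.blockDiagonal_one
  let D0 : Matrix (l × G) (l × G) A := Matrix.blockDiagonal fun g => c.map (α g)
  have hD0 : IsPosElem D0 := pos_blockDiagonal fun g => pos_map' (α g) hc
  let D : Matrix (G × l) (G × l) A := D0.submatrix (Equiv.prodComm G l) (Equiv.prodComm G l)
  have hD : IsPosElem D := posElem_submatrix _ hD0
  let x' : Matrix (G × l) (G × l) A := U.conjTranspose * D * U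
  have hx' : ∀ h i h' j, x' (h, i) (h', j) = ∑ g, α g (star (e h s) * c i j * e h' s) := by
    intro h i h' j
    simp only [x', Matrix.mul_apply, Fintype.sum_prod_type, Matrix.conjTranspose_apply, U, D, D0,
      Matrix.blockDiagonal_apply, Matrix.submatrix_apply, Equiv.prodComm_apply, Prod.swap_prod_mk,
      Matrix.map_apply, hV, map_mul, map_star]
    simp only [mul_ite, mul_zero, Finset.sum_ite_eq', Finset.sum_ite_eq, Finset.mem_univ, if_true,
      apply_ite star, star_zero, ite_mul, zero_mul]
    refine Finset.sum_congr rfl fun g _ => ?_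
    congr 1
    rw [Finset.sum_eq_single g, Finset.sum_eq_single i]
    · simp
    · intro b _ hb; simp [hb]
    · simp
    · intro b _ hb; simp [hb]
    · simp
  have hfix : ∀ g, x'.map (α g) = x' := by
    intro g
    ext ⟨h, i⟩ ⟨h', j⟩
    rw [Matrix.map_apply, hx', map_sum]
    simp only [hact.2]
    exact Fintype.sum_equiv (Equiv.mulLeft g) _ _ fun h => rfl
  have hx'p : IsPosElem x' := by
    have := pos_conj hD U.conjTranspose
    rwa [Matrix.conjTranspose_conjTranspose] at this
  obtain ⟨x, hx⟩ := vlift hfix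
  refine ⟨x, pos_of_vmap (by rw [hx]; exact hx'p), fun τ hτ => ?_⟩
  rw [hx, ← dimFun_blockDiagonal hτ (fun g => pos_map' (α g) hc)]
  change dimFun τ x' = dimFun τ D0
  rw [← dimFun_submatrix hτ (Equiv.prodComm G l) hD0]
  apply le_antisymm
  · have := dim_conj hτ hD U.conjTranspose
    rwa [Matrix.conjTranspose_conjTranspose] at this
  · have h1 := dim_conj hτ hx'p W.conjTranspose
    have e1 : W.conjTranspose * x' * W.conjTranspose.conjTranspose = D := by
      have hWU : W.conjTranspose * U.conjTranspose = 1 := by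
        rw [← Matrix.conjTranspose_mul, hUW, Matrix.conjTranspose_one]
      rw [Matrix.conjTranspose_conjTranspose]
      calc W.conjTranspose * (U.conjTranspose * D * U) * W
          = (W.conjTranspose * U.conjTranspose) * D * (U * W) := by simp only [Matrix.mul_assoc]
        _ = D := by rw [hWU, hUW, Matrix.one_mul, Matrix.mul_one]
    rwa [e1] at h1

theorem vmap_blockDiagonal (y : Matrix m m (fixedPointAlgebra α)) :
    vmap (Matrix.blockDiagonal fun _ : k => y) = Matrix.blockDiagonal fun _ : k => vmap y :=
  Matrix.blockDiagonal_map _ (fun x : fixedPointAlgebra α => (x : A)) rfl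

theorem dim_vbd {τ : A →ₗ[ℂ] ℂ} (hτ : IsTracialState τ) {y : Matrix m m (fixedPointAlgebra α)}
    (hy : IsPosElem y) : dimFun τ (vmap (Matrix.blockDiagonal fun _ : k => y)) =
      Fintype.card k * dimFun τ (vmap y) := by
  rw [vmap_blockDiagonal, dimFun_blockDiagonal hτ fun _ => vmap_pos hy, Finset.sum_const,
    Finset.card_univ, nsmul_eq_mul]

theorem div_fix (hs : IsSimpleCStarAlgebra A) (hact : IsGroupAction α) (R : Rok α e)
    (hsc : HasStrictComparison A) (had : AlmostDivisible A) :
    AlmostDivisible (fixedPointAlgebra α) := by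
  intro m a ha ha1 k hk
  by_cases hne : vmap a = 0
  · have ha0 : a = 0 := vmap_inj (by rw [hne]; ext i j; rfl)
    refine ⟨0, 0, ⟨0, by simp⟩, ⟨fun _ => 0, ?_⟩, ⟨fun _ => 0, ?_⟩⟩
    · have : (Matrix.blockDiagonal fun _ : Fin k => (0 : Matrix (Fin 0) (Fin 0) (fixedPointAlgebra α))) = 0 := by
        ext ⟨i, _⟩; exact i.elim0
      rw [this]; simpa using tendsto_const_nhds
    · rw [ha0]; simpa using tendsto_const_nhds
  have hap := vmap_pos ha
  have hap1 : IsPosElem (1 - vmap a) := by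
    have := vmap_pos ha1
    have e1 : vmap (1 - a) = vmap (1 : Matrix (Fin m) (Fin m) (fixedPointAlgebra α)) - vmap a := by
      ext i j; rfl
    rwa [e1, vmap_one] at this
  set n := Fintype.card G with hn
  have hn0 : 0 < n := Fintype.card_pos
  set K := 3 * n * k + 1 with hK
  obtain ⟨l, c, hc, h1, h2⟩ := had m (vmap a) hap hap1 K (by omega)
  obtain ⟨x, hx, hxd⟩ := build hact R hc
  let X0 : Matrix ((G × Fin l) × Fin 3) ((G × Fin l) × Fin 3) (fixedPointAlgebra α) :=
    Matrix.blockDiagonal fun _ => x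
  have hX0 : IsPosElem X0 := pos_of_vmap (by
    rw [vmap_blockDiagonal]; exact pos_blockDiagonal fun _ => vmap_pos hx)
  have hdX : ∀ τ : A →ₗ[ℂ] ℂ, IsTracialState τ →
      dimFun τ (vmap X0) = 3 * ∑ g, dimFun τ (c.map (α g)) := by
    intro τ hτ
    rw [dim_vbd hτ hx, hxd τ hτ]; norm_num
  have hg1 : ∀ τ : A →ₗ[ℂ] ℂ, IsTracialState τ → ∀ g,
      (K : ℝ) * dimFun τ (c.map (α g)) ≤ dimFun τ (vmap a) ∧
      dimFun τ (vmap a) ≤ ((K : ℝ) + 1) * dimFun τ (c.map (α g)) := by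
    intro τ hτ g
    have hcg : IsPosElem (c.map (α g)) := pos_map' (α g) hc
    have a1 := cs_map' (α g) h1
    have a2 := cs_map' (α g) h2
    rw [vmap_fix, Matrix.blockDiagonal_map _ _ (map_zero (α g))] at a1 a2
    have b1 := dim_mono hτ (pos_blockDiagonal fun _ => hcg) hap a1
    have b2 := dim_mono hτ hap (pos_blockDiagonal fun _ => hcg) a2
    rw [dimFun_blockDiagonal hτ fun _ => hcg] at b1 b2
    simp only [Finset.sum_const, Finset.card_univ, Fintype.card_fin, nsmul_eq_mul] at b1 b2
    push_cast at b2
    exact ⟨b1, b2⟩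
  have hsum : ∀ τ : A →ₗ[ℂ] ℂ, IsTracialState τ →
      (K : ℝ) * ∑ g, dimFun τ (c.map (α g)) ≤ n * dimFun τ (vmap a) ∧
      n * dimFun τ (vmap a) ≤ ((K : ℝ) + 1) * ∑ g, dimFun τ (c.map (α g)) := by
    intro τ hτ
    have e1 : (n : ℝ) * dimFun τ (vmap a) = ∑ g : G, dimFun τ (vmap a) := by
      rw [Finset.sum_const, Finset.card_univ, nsmul_eq_mul]
    rw [e1, Finset.mul_sum, Finset.mul_sum]
    exact ⟨Finset.sum_le_sum fun g _ => (hg1 τ hτ g).1, Finset.sum_le_sum fun g _ => (hg1 τ hτ g).2⟩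
  have hnR : (1 : ℝ) ≤ n := by exact_mod_cast hn0
  have hkR : (1 : ℝ) ≤ k := by exact_mod_cast Nat.one_le_iff_ne_zero.2 hk
  have hKR : (K : ℝ) = 3 * n * k + 1 := by rw [hK]; push_cast; ring
  have r1 : CuntzSub (Matrix.blockDiagonal fun _ : Fin k => X0) a := by
    refine transfer hact R (sc_gen hsc ?_ hap fun τ hτ => ?_)
    · rw [vmap_blockDiagonal]; exact pos_blockDiagonal fun _ => vmap_pos hX0
    rw [dim_vbd hτ hX0, hdX τ hτ, Fintype.card_fin]
    have := (hsum τ hτ).1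
    have hd := dim_pos hs hτ hap hne
    set d := dimFun τ (vmap a)
    set S := ∑ g, dimFun τ (c.map (α g))
    rw [hKR] at this
    rcases le_or_gt S 0 with hS | hS
    · have : (k : ℝ) * (3 * S) ≤ 0 := mul_nonpos_of_nonneg_of_nonpos (by positivity) (by linarith)
      linarith
    · have h3 : (n : ℝ) * (k * (3 * S)) < n * d := by linarith
      exact lt_of_mul_lt_mul_left h3 (by positivity)
  have r2 : CuntzSub a (Matrix.blockDiagonal fun _ : Fin (k + 1) => X0) := by
    refine transfer hact R (sc_gen hsc hap ?_ fun τ hτ => ?_)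
    · rw [vmap_blockDiagonal]; exact pos_blockDiagonal fun _ => vmap_pos hX0
    rw [dim_vbd hτ hX0, hdX τ hτ, Fintype.card_fin]
    have := (hsum τ hτ).2
    have hd := dim_pos hs hτ hap hne
    set d := dimFun τ (vmap a)
    set S := ∑ g, dimFun τ (c.map (α g))
    rw [hKR] at this
    push_cast
    have hnd : 0 < (n : ℝ) * d := by positivity
    have hS : 0 < S := by
      by_contra hS
      have : ((3 * n * k + 1 : ℝ) + 1) * S ≤ 0 :=
        mul_nonpos_of_nonneg_of_nonpos (by positivity) (not_lt.1 hS)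
      linarith
    have h3 : (n : ℝ) * d < n * ((k + 1) * (3 * S)) := by nlinarith
    exact lt_of_mul_lt_mul_left h3 (by positivity)
  let f := (Fintype.equivFin ((G × Fin l) × Fin 3)).symm
  refine ⟨_, X0.submatrix f f, posElem_submatrix f hX0, ?_, ?_⟩
  · rw [blockDiag_submatrix f fun _ : Fin k => X0]
    exact cs_left _ r1
  · rw [blockDiag_submatrix f fun _ : Fin (k + 1) => X0]
    exact cs_right _ r2

end Div

open TopologicalSpace in
theorem stmt18 (A : Type) [CStarAlgebra A] [SeparableSpace A]
    (hsimple : IsSimpleCStarAlgebra A) (hexact : IsExactCStar A)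
    (hpure : IsPure A) (hsr : HasStableRankOne A)
    (G : Type) [Group G] [Fintype G] (α : G → (A →⋆ₐ[ℂ] A))
    (hact : IsGroupAction α) (hRok : ActionHasRokhlin α) :
    IsPure (fixedPointAlgebra α) := by
  classical
  let _ := CStarAlgebra.spectralOrder A
  have _ := CStarAlgebra.spectralOrderedRing A
  obtain ⟨e, R⟩ := rok_of hRok
  exact ⟨strict_fix hact R hpure.1, div_fix hsimple hact R hpure.1 hpure.2⟩

end
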